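/- arXiv:math/0101086 — 4 statements merged into one kernel-verified Lean document; each statement's English description precedes it below -/
import Mathlib

section
/- Let (R, m) be a local ring with infinite residue field and let G(R) = ⊕_{n≥0} m^n/m^{n+1} be its associated graded ring. Then r(R) = r(G(R)). -/
namespace CMReg

section Reduction

variable {A : Type} [CommRing A]

/-- `q` is a reduction of the ideal `M` (i.e. `M^(s+1) = q * M^s` for some `s`). -/
def IsReduction (M q : Ideal A) : Prop :=
  q ≤ M ∧ ∃ s : ℕ, M ^ (s + 1) = q * M ^ s

/-- The reduction number of `A` with respect to the reduction `q` of `M`. -/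
noncomputable def redIdx (M q : Ideal A) : ℕ :=
  sInf {s : ℕ | M ^ (s + 1) = q * M ^ s}

/-- A minimal reduction: a reduction containing no other reduction. -/
def IsMinReduction (M q : Ideal A) : Prop :=
  IsReduction M q ∧ ∀ q' ≤ q, IsReduction M q' → q' = q

/-- The reduction number `r(A)` of a local ring `A` with maximal ideal `M`:
the minimum of the reduction numbers with respect to minimal reductions of `M`. -/
noncomputable def locRedNum (M : Ideal A) : ℕ :=
  sInf {s : ℕ | ∃ q : Ideal A, IsMinReduction M q ∧ redIdx M q = s}

/-- `V` (with `M² ≤ V ≤ M`, encoding the space `V/M²` of linear forms of the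
associated graded ring `G(A) = ⊕ Mⁿ/Mⁿ⁺¹`) generates a reduction of `G(A)`:
the ideal `J` of `G(A)` generated by the degree-one part `V/M²` satisfies
`Jₙ = G(A)ₙ` for all large `n`. -/
def IsGReduction (M V : Ideal A) : Prop :=
  M ^ 2 ≤ V ∧ V ≤ M ∧ ∃ n₀ : ℕ, ∀ s ≥ n₀, M ^ (s + 1) ≤ V * M ^ s ⊔ M ^ (s + 2)

/-- The reduction number of the associated graded ring `G(A)` with respect to the
graded reduction determined by `V`. -/
noncomputable def gRedIdx (M V : Ideal A) : ℕ :=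
  sInf {n₀ : ℕ | ∀ s ≥ n₀, M ^ (s + 1) ≤ V * M ^ s ⊔ M ^ (s + 2)}

/-- Minimal graded reduction of the associated graded ring. -/
def IsMinGReduction (M V : Ideal A) : Prop :=
  IsGReduction M V ∧ ∀ V' : Ideal A, M ^ 2 ≤ V' → V' ≤ V → IsGReduction M V' → V' = V

/-- The reduction number `r(G(A))` of the associated graded ring of `A` with respect
to the ideal `M` (minimum of reduction numbers over minimal graded reductions). -/
noncomputable def gRedNumAssocGraded (M : Ideal A) : ℕ :=
  sInf {s : ℕ | ∃ V : Ideal A, IsMinGReduction M V ∧ gRedIdx M V = s}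

end Reduction

end CMReg

open CMReg IsLocalRing

namespace CMReg

section Comparison

variable {R : Type} [CommRing R]

theorem pow_succ_eq_mul_pow_of_le {M q : Ideal R} {s t : ℕ} (h : M ^ (s + 1) = q * M ^ s)
    (hst : s ≤ t) : M ^ (t + 1) = q * M ^ t := by
  obtain ⟨d, rfl⟩ := Nat.exists_eq_add_of_le hst
  rw [show s + d + 1 = (s + 1) + d by ring, pow_add, h, pow_add, mul_assoc]

variable [IsLocalRing R] [IsNoetherianRing R]

/-- By Nakayama's lemma, the degree `s + 1` part of the ideal of the associated graded ring
generated by `(q + m²) / m²` is everything if and only if `m ^ (s + 1) = q * m ^ s`. -/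
theorem pow_succ_le_iff {q : Ideal R} (hq : q ≤ maximalIdeal R) (s : ℕ) :
    maximalIdeal R ^ (s + 1) ≤
        (q ⊔ maximalIdeal R ^ 2) * maximalIdeal R ^ s ⊔ maximalIdeal R ^ (s + 2) ↔
      maximalIdeal R ^ (s + 1) = q * maximalIdeal R ^ s := by
  set M := maximalIdeal R
  have e : (q ⊔ M ^ 2) * M ^ s ⊔ M ^ (s + 2) = q * M ^ s ⊔ M • M ^ (s + 1) := by
    rw [Ideal.sup_mul, ← pow_add, add_comm 2 s, sup_assoc, sup_idem, smul_eq_mul, ← pow_succ']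
  rw [e]
  constructor
  · intro h
    apply le_antisymm
    · exact Submodule.le_of_le_smul_of_le_jacobson_bot (IsNoetherian.noetherian _)
        (maximalIdeal_le_jacobson ⊥) h
    · rw [pow_succ']
      exact Ideal.mul_mono_left hq
  · intro h
    exact h.le.trans le_sup_left

theorem forall_pow_succ_le_iff {q : Ideal R} (hq : q ≤ maximalIdeal R) (n : ℕ) :
    (∀ s ≥ n, maximalIdeal R ^ (s + 1) ≤
        (q ⊔ maximalIdeal R ^ 2) * maximalIdeal R ^ s ⊔ maximalIdeal R ^ (s + 2)) ↔
      maximalIdeal R ^ (n + 1) = q * maximalIdeal R ^ n := by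
  simp only [pow_succ_le_iff hq]
  exact ⟨fun h => h n le_rfl, fun h s hs => pow_succ_eq_mul_pow_of_le h hs⟩

theorem isGReduction_sup_sq_iff {q : Ideal R} (hq : q ≤ maximalIdeal R) :
    IsGReduction (maximalIdeal R) (q ⊔ maximalIdeal R ^ 2) ↔
      IsReduction (maximalIdeal R) q := by
  simp only [IsGReduction, IsReduction, forall_pow_succ_le_iff hq]
  exact ⟨fun h => ⟨hq, h.2.2⟩,
    fun h => ⟨le_sup_right, sup_le hq (Ideal.pow_le_self two_ne_zero), h.2⟩⟩

theorem gRedIdx_sup_sq {q : Ideal R} (hq : q ≤ maximalIdeal R) :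
    gRedIdx (maximalIdeal R) (q ⊔ maximalIdeal R ^ 2) = redIdx (maximalIdeal R) q := by
  simp only [gRedIdx, redIdx, forall_pow_succ_le_iff hq]

theorem IsMinReduction.isMinGReduction_sup_sq {q : Ideal R}
    (h : IsMinReduction (maximalIdeal R) q) :
    IsMinGReduction (maximalIdeal R) (q ⊔ maximalIdeal R ^ 2) := by
  have hq := h.1.1
  refine ⟨(isGReduction_sup_sq_iff hq).2 h.1, fun V hV hle hred => le_antisymm hle ?_⟩
  have hV' : V ⊓ q ⊔ maximalIdeal R ^ 2 = V := by
    rw [inf_sup_assoc_of_le _ hV, inf_eq_left.2 hle]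
  have hmin := h.2 (V ⊓ q) inf_le_right
    ((isGReduction_sup_sq_iff (inf_le_right.trans hq)).1 (by rwa [hV']))
  exact sup_le (inf_eq_right.1 hmin) hV

/-- Lifting a basis of `V / I`: an ideal `V ≥ I` is of the form `q ⊔ I` with `q ⊓ I ≤ m q`. -/
theorem exists_sup_eq_and_inf_le_maximalIdeal_mul {I V : Ideal R} (h : I ≤ V) :
    ∃ q : Ideal R, q ⊔ I = V ∧ q ⊓ I ≤ maximalIdeal R * q := by
  classical
  obtain ⟨S₀, hS₀⟩ := (IsNoetherian.noetherian V : V.FG)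
  obtain ⟨S, hS⟩ := exists_minimal_of_wellFoundedLT
    (fun S : Finset R => Ideal.span (S : Set R) ⊔ I = V)
    ⟨S₀, by rw [Ideal.span, hS₀, sup_eq_left.2 h]⟩
  refine ⟨Ideal.span S, hS.prop, ?_⟩
  rintro x ⟨hx, hxI⟩
  obtain ⟨f, -, rfl⟩ := Submodule.mem_span_finset.1 hx
  refine Ideal.sum_mem _ fun a ha => Ideal.mul_mem_mul ?_ (Ideal.subset_span ha)
  by_contra hfa
  have hu : IsUnit (f a) := by simpa using hfa
  have hrest : ∑ b ∈ S.erase a, f b • b ∈ Ideal.span (S.erase a : Set R) :=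
    Ideal.sum_mem _ fun b hb => Ideal.mul_mem_left _ _ (Ideal.subset_span hb)
  have hmem : a ∈ Ideal.span (S.erase a : Set R) ⊔ I := by
    rw [← Ideal.unit_mul_mem_iff_mem _ hu]
    rw [← Finset.add_sum_erase S _ ha] at hxI
    have := sub_mem (Ideal.mem_sup_right (S := Ideal.span (S.erase a : Set R)) hxI)
      (Ideal.mem_sup_left (T := I) hrest)
    simpa using this
  have herase : Ideal.span (S.erase a : Set R) ⊔ I = V := by
    apply le_antisymm
    · rw [← hS.prop]
      exact sup_le_sup_right (Ideal.span_mono (by simp)) _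
    · rw [← hS.prop]
      refine sup_le (Ideal.span_le.2 fun b hb => ?_) le_sup_right
      by_cases hba : b = a
      · exact hba ▸ hmem
      · exact Ideal.mem_sup_left (Ideal.subset_span (Finset.mem_erase.2 ⟨hba, hb⟩))
  exact Finset.notMem_erase a S (hS.le_of_le herase (Finset.erase_subset a S) ha)

theorem IsMinGReduction.exists_isMinReduction {V : Ideal R}
    (h : IsMinGReduction (maximalIdeal R) V) :
    ∃ q, IsMinReduction (maximalIdeal R) q ∧ q ⊔ maximalIdeal R ^ 2 = V := by
  obtain ⟨q, rfl, hinf⟩ := exists_sup_eq_and_inf_le_maximalIdeal_mul h.1.1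
  have hq : q ≤ maximalIdeal R := le_sup_left.trans h.1.2.1
  refine ⟨q, ⟨(isGReduction_sup_sq_iff hq).1 h.1, fun q' hle hred => le_antisymm hle ?_⟩, rfl⟩
  have hsup := h.2 _ le_sup_right (sup_le_sup_right hle _)
    ((isGReduction_sup_sq_iff (hle.trans hq)).2 hred)
  refine Submodule.le_of_le_smul_of_le_jacobson_bot (I := maximalIdeal R)
    (IsNoetherian.noetherian _) (maximalIdeal_le_jacobson ⊥) ?_
  calc q ≤ (q' ⊔ maximalIdeal R ^ 2) ⊓ q := le_inf (hsup ▸ le_sup_left) le_rfl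
    _ = q' ⊔ maximalIdeal R ^ 2 ⊓ q := sup_inf_assoc_of_le _ hle
    _ ≤ q' ⊔ maximalIdeal R • q := sup_le_sup_left (inf_comm q _ ▸ hinf) _

end Comparison

end CMReg

/-- Let `(R, m)` be a (Noetherian) local ring with infinite residue
field and let `G(R) = ⊕ₙ mⁿ/mⁿ⁺¹` be its associated graded ring.  Then
`r(R) = r(G(R))`.  (A graded reduction of `G(R)` generated by degree-one forms is
encoded by the ideal `V` with `m² ≤ V ≤ m` corresponding to its degree-one part
`V/m² ⊆ G(R)₁`; see `CMReg.IsGReduction`.) -/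
theorem statement_1 {R : Type} [CommRing R] [IsLocalRing R] [IsNoetherianRing R]
    [Infinite (ResidueField R)] :
    locRedNum (maximalIdeal R) = gRedNumAssocGraded (maximalIdeal R) := by
  unfold locRedNum gRedNumAssocGraded
  congr 1
  ext s
  constructor
  · rintro ⟨q, hq, rfl⟩
    exact ⟨_, hq.isMinGReduction_sup_sq, gRedIdx_sup_sq hq.1.1⟩
  · rintro ⟨V, hV, rfl⟩
    obtain ⟨q, hq, rfl⟩ := hV.exists_isMinReduction
    exact ⟨q, hq, (gRedIdx_sup_sq hq.1.1).symm⟩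
end

section
/- Let (R, m) be a local ring with infinite residue field and d = dim R. For a generic choice of elements z_1,…,z_d in m \ m^2, the ideal q = (z_1,…,z_d) is a minimal reduction of m with r_q(R) = r(R). -/
open CMReg IsLocalRing

section Length
variable {R : Type*} [CommRing R]

theorem length_quotient_eq_add {I J : Ideal R} (h : I ≤ J) :
    Module.length R (R ⧸ I) =
      Module.length R (Submodule.map (Submodule.mkQ I) J) + Module.length R (R ⧸ J) := by
  rw [← (Submodule.quotientQuotientEquivQuotient I J h).length_eq]
  exact Module.length_eq_add_of_exact (Submodule.map (Submodule.mkQ I) J).subtype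
    (Submodule.map (Submodule.mkQ I) J).mkQ (Submodule.subtype_injective _)
    (Submodule.mkQ_surjective _) (LinearMap.exact_subtype_mkQ _)

theorem length_quotient_sup_span_pow_le (J : Ideal R) (a : R) (n : ℕ) :
    Module.length R (R ⧸ (J ⊔ Ideal.span {a ^ n})) ≤
      n * Module.length R (R ⧸ (J ⊔ Ideal.span {a})) := by
  induction n with
  | zero =>
    have : Subsingleton (R ⧸ (J ⊔ Ideal.span {a ^ 0})) := by
      rw [Ideal.Quotient.subsingleton_iff]; simp [Ideal.span_singleton_one]
    simp [Module.length_eq_zero]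
  | succ n ih =>
    have hle : J ⊔ Ideal.span {a ^ (n + 1)} ≤ J ⊔ Ideal.span {a ^ n} := by
      refine sup_le_sup_left ?_ J
      rw [Ideal.span_singleton_le_span_singleton]
      exact pow_dvd_pow a n.le_succ
    rw [length_quotient_eq_add hle, Nat.cast_succ, add_mul, one_mul, add_comm]
    refine add_le_add ih ?_
    let f : R →ₗ[R] (R ⧸ (J ⊔ Ideal.span {a ^ (n + 1)})) :=
      (Submodule.mkQ (J ⊔ Ideal.span {a ^ (n + 1)})).comp (LinearMap.mulLeft R (a ^ n))
    have hf : J ⊔ Ideal.span {a} ≤ LinearMap.ker f := by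
      refine sup_le (fun x hx => ?_) ?_
      · simp only [LinearMap.mem_ker, f, LinearMap.comp_apply, LinearMap.mulLeft_apply,
          Submodule.mkQ_apply, Submodule.Quotient.mk_eq_zero]
        exact Ideal.mem_sup_left (Ideal.mul_mem_left _ _ hx)
      · rw [Ideal.span_singleton_le_iff_mem]
        simp only [LinearMap.mem_ker, f, LinearMap.comp_apply, LinearMap.mulLeft_apply,
          Submodule.mkQ_apply, Submodule.Quotient.mk_eq_zero]
        exact Ideal.mem_sup_right (by rw [← pow_succ]; exact Ideal.mem_span_singleton_self _)
    let g := Submodule.liftQ _ f hf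
    have hg : Submodule.map (Submodule.mkQ (J ⊔ Ideal.span {a ^ (n + 1)}))
        (J ⊔ Ideal.span {a ^ n}) ≤ LinearMap.range g := by
      rw [Submodule.map_le_iff_le_comap]
      refine sup_le (fun x hx => ?_) ?_
      · have : Submodule.mkQ (J ⊔ Ideal.span {a ^ (n + 1)}) x = 0 := by
          rw [Submodule.mkQ_apply, Submodule.Quotient.mk_eq_zero]
          exact Ideal.mem_sup_left hx
        rw [Submodule.mem_comap, this]
        exact zero_mem _
      · rw [Ideal.span_singleton_le_iff_mem, Submodule.mem_comap]
        exact ⟨Submodule.Quotient.mk 1, (Submodule.liftQ_apply _ _ _).trans (by simp [f])⟩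
    exact (Module.length_le_of_injective _ (Submodule.inclusion_injective hg)).trans
      (Module.length_le_of_surjective g.rangeRestrict g.surjective_rangeRestrict)

theorem length_quotient_sup_span_image_pow_le (T : Finset R) (J : Ideal R) (n : ℕ) :
    Module.length R (R ⧸ (J ⊔ Ideal.span ((fun a => a ^ n) '' (T : Set R)))) ≤
      (n : ℕ∞) ^ T.card * Module.length R (R ⧸ (J ⊔ Ideal.span (T : Set R))) := by
  classical
  induction T using Finset.induction_on generalizing J with
  | empty =>
    rw [Finset.coe_empty, Set.image_empty]
    simp
  | insert a T ha ih =>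
    have h₁ := length_quotient_sup_span_pow_le
      (J ⊔ Ideal.span ((fun a => a ^ n) '' (T : Set R))) a n
    have h₂ := ih (J ⊔ Ideal.span {a})
    rw [Finset.coe_insert, Set.image_insert_eq, Ideal.span_insert, Ideal.span_insert,
      Finset.card_insert_of_notMem ha, pow_succ', mul_assoc, sup_comm (Ideal.span {a ^ n}),
      ← sup_assoc, ← sup_assoc]
    refine h₁.trans (mul_le_mul_right ?_ _)
    rwa [sup_right_comm]

theorem length_quotient_le_of_le {I J : Ideal R} (h : I ≤ J) :
    Module.length R (R ⧸ J) ≤ Module.length R (R ⧸ I) :=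
  Module.length_le_of_surjective (Submodule.factor h) (Submodule.factor_surjective h)

end Length

section HomogeneousRelation
variable {R : Type*} [CommRing R] [IsLocalRing R]

theorem card_add_length_quotient_le {ι : Type*} (T : Finset ι) (v : ι → R) {I J : Ideal R}
    (hIJ : I ≤ J) (hv : ∀ e ∈ T, v e ∈ J)
    (hind : ∀ r : ι → R, ∑ e ∈ T, r e * v e ∈ I → ∀ e ∈ T, r e ∈ maximalIdeal R) :
    (T.card : ℕ∞) + Module.length R (R ⧸ J) ≤ Module.length R (R ⧸ I) := by
  classical
  rw [length_quotient_eq_add hIJ]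
  refine add_le_add_left ?_ _
  let f : (T → R) →ₗ[R] R ⧸ I :=
    (Submodule.mkQ I).comp (Fintype.linearCombination R (fun e : T => v e))
  let g : (T → R) →ₗ[R] (T → ResidueField R) :=
    LinearMap.compLeft (Algebra.linearMap R (ResidueField R)) T
  have hg : Function.Surjective g := fun x => by
    choose y hy using fun e => residue_surjective (R := R) (x e)
    exact ⟨y, funext hy⟩
  have hfg : LinearMap.ker f ≤ LinearMap.ker g := by
    intro r hr
    simp only [LinearMap.mem_ker, f, LinearMap.comp_apply, Fintype.linearCombination_apply,
      Submodule.mkQ_apply, Submodule.Quotient.mk_eq_zero, smul_eq_mul] at hr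
    have := hind (fun e => if h : e ∈ T then r ⟨e, h⟩ else 0) (by
      rw [← Finset.sum_coe_sort]; simpa using hr)
    rw [LinearMap.mem_ker]
    funext e
    have h := this e e.2
    simp only [Finset.coe_mem, dite_true] at h
    exact (residue_eq_zero_iff _).mpr h
  have hf : LinearMap.range f ≤ Submodule.map (Submodule.mkQ I) J := by
    rintro _ ⟨r, rfl⟩
    refine ⟨_, ?_, rfl⟩
    rw [Fintype.linearCombination_apply]
    exact sum_mem fun e _ => J.mul_mem_left _ (hv e e.2)
  have hs : Module.length R (ResidueField R) = 1 :=
    (Module.length_eq_of_surjective residue_surjective).trans (Module.length_eq_one _ _)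
  have h1 : Module.length R (T → ResidueField R) = T.card := by
    rw [Module.length_pi_of_fintype]; simp [hs]
  rw [← h1]
  calc Module.length R (T → ResidueField R)
      ≤ Module.length R ((T → R) ⧸ LinearMap.ker f) :=
        Module.length_le_of_surjective (Submodule.liftQ _ g hfg) (by
          intro x; obtain ⟨y, rfl⟩ := hg x; exact ⟨Submodule.Quotient.mk y, by simp⟩)
    _ = Module.length R (LinearMap.range f) := f.quotKerEquivRange.length_eq
    _ ≤ _ := Module.length_le_of_injective _ (Submodule.inclusion_injective hf)

theorem prod_pow_mem_pow {ι A : Type*} [CommRing A] [Fintype ι] {M : Ideal A} {w : ι → A}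
    (hw : ∀ i, w i ∈ M) (e : ι → ℕ) : ∏ i, w i ^ e i ∈ M ^ ∑ i, e i := by
  rw [← Finset.prod_pow_eq_pow_sum]
  exact Ideal.prod_mem_prod fun i _ => Ideal.pow_mem_pow (hw i) _

theorem card_le_length_quotient_of_independent {ι : Type*} [Fintype ι] {w : ι → R}
    (hw : ∀ i, w i ∈ maximalIdeal R)
    (hind : ∀ (n : ℕ) (T : Finset (ι → ℕ)), (∀ e ∈ T, ∑ i, e i = n) → ∀ r : (ι → ℕ) → R,
      ∑ e ∈ T, r e * ∏ i, w i ^ e i ∈ maximalIdeal R ^ (n + 1) →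
        ∀ e ∈ T, r e ∈ maximalIdeal R)
    (T : Finset (ι → ℕ)) (K : ℕ) :
    ((T.filter fun e => ∑ i, e i < K).card : ℕ∞) ≤
      Module.length R (R ⧸ maximalIdeal R ^ K) := by
  classical
  induction K with
  | zero => simp
  | succ n ih =>
    have := card_add_length_quotient_le (T.filter fun e => ∑ i, e i = n)
      (fun e => ∏ i, w i ^ e i) (Ideal.pow_le_pow_right n.le_succ : maximalIdeal R ^ (n + 1) ≤ _)
      (fun e he => (Finset.mem_filter.mp he).2 ▸ prod_pow_mem_pow hw e)
      (hind n _ fun e he => (Finset.mem_filter.mp he).2)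
    refine le_trans ?_ ((add_le_add_right ih _).trans this)
    norm_cast
    refine (Finset.card_le_card ?_).trans (Finset.card_union_le _ _)
    intro e
    simp only [Finset.mem_filter, Finset.mem_union]
    grind

/-- If `w` is a family of more than `dim R` elements of the maximal ideal, there is a homogeneous
relation of some degree `n` between the initial forms of `w`. -/
theorem exists_homogeneous_relation [IsNoetherianRing R] {d : ℕ}
    (hd : (d : WithBot (WithTop ℕ)) = ringKrullDim R) {ι : Type*} [Fintype ι]
    (hι : d < Fintype.card ι) {w : ι → R} (hw : ∀ i, w i ∈ maximalIdeal R) :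
    ∃ (n : ℕ) (T : Finset (ι → ℕ)) (r : (ι → ℕ) → R), (∀ e ∈ T, ∑ i, e i = n) ∧
      ∑ e ∈ T, r e * ∏ i, w i ^ e i ∈ maximalIdeal R ^ (n + 1) ∧
        ∃ e ∈ T, r e ∉ maximalIdeal R := by
  classical
  by_contra! hind
  have hind' := card_le_length_quotient_of_independent hw
    fun n T hT r hr => hind n T r hT hr
  obtain ⟨X, hX, hXd⟩ := (maximalIdeal R).exists_finset_card_eq_height_of_isNoetherianRing
  have hXd : X.card = d := by
    have := maximalIdeal_height_eq_ringKrullDim (R := R)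
    rw [← hd, ← hXd] at this
    have h : (X.card : WithBot ℕ∞) = (d : WithBot ℕ∞) := this
    exact_mod_cast h
  have hXm : Ideal.span (X : Set R) ≤ maximalIdeal R := hX.1.2
  have hart := quotient_artinian_of_mem_minimalPrimes_of_isLocalRing _ hX
  have hfin : Module.length R (R ⧸ Ideal.span (X : Set R)) ≠ ⊤ := by
    rw [Module.length_eq_of_surjective (S := R) (R := R ⧸ Ideal.span (X : Set R))
      (M := R ⧸ Ideal.span (X : Set R)) Ideal.Quotient.mk_surjective]
    exact Module.length_ne_top
  obtain ⟨L, hL⟩ := ENat.ne_top_iff_exists.mp hfin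
  set l := Fintype.card ι with hl
  have key : ∀ n : ℕ, 0 < n → n ^ l ≤ (l * n) ^ d * L := by
    intro n hn
    have hlpos : 0 < l := by omega
    have hne : Nonempty ι := Fintype.card_pos_iff.mp hlpos
    have h1 := hind' (Fintype.piFinset fun _ => Finset.range n) (l * n)
    have h2 : ((Fintype.piFinset fun _ : ι => Finset.range n).filter
        fun e => ∑ i, e i < l * n).card = n ^ l := by
      rw [Finset.filter_true_of_mem, Fintype.card_piFinset]
      · simp [hl]
      · intro e he
        have : ∑ i, e i < ∑ _i : ι, n := Finset.sum_lt_sum_of_nonempty Finset.univ_nonempty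
          fun i _ => Finset.mem_range.mp (Fintype.mem_piFinset.mp he i)
        simpa [hl] using this
    have h3 := length_quotient_sup_span_image_pow_le X ⊥ (l * n)
    rw [bot_sup_eq, bot_sup_eq, ← hL, hXd] at h3
    have h4 : Ideal.span ((fun a => a ^ (l * n)) '' (X : Set R)) ≤ maximalIdeal R ^ (l * n) := by
      rw [Ideal.span_le]
      rintro _ ⟨a, ha, rfl⟩
      exact Ideal.pow_mem_pow (hXm (Ideal.subset_span ha)) _
    rw [h2] at h1
    exact_mod_cast (h1.trans (length_quotient_le_of_le h4)).trans h3
  have h := key (l ^ d * L + 1) (by omega)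
  have h5 : (l ^ d * L + 1) ^ (d + 1) ≤ (l ^ d * L + 1) ^ l :=
    Nat.pow_le_pow_right (by omega) hι
  have h6 := h5.trans h
  rw [mul_pow, pow_succ', mul_right_comm] at h6
  have := Nat.le_of_mul_le_mul_right h6 (by positivity)
  omega

end HomogeneousRelation

section Perturbation
variable {A : Type} [CommRing A]

theorem mul_sub_mul_mem {M V : Ideal A} {m n : ℕ} {a b a' b' : A} (hb : b ∈ M ^ m)
    (hab : a - b ∈ V * M ^ (m - 1)) (ha' : a' ∈ M ^ n) (hab' : a' - b' ∈ V * M ^ (n - 1)) :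
    a * a' - b * b' ∈ V * M ^ (m + n - 1) := by
  have h₁ : (a - b) * a' ∈ V * M ^ (m + n - 1) := by
    have h := Ideal.mul_mem_mul hab ha'
    rw [mul_assoc, ← pow_add] at h
    exact Ideal.mul_mono_right (Ideal.pow_le_pow_right (by omega)) h
  have h₂ : b * (a' - b') ∈ V * M ^ (m + n - 1) := by
    have h := Ideal.mul_mem_mul hb hab'
    rw [mul_left_comm, ← pow_add] at h
    exact Ideal.mul_mono_right (Ideal.pow_le_pow_right (by omega)) h
  convert add_mem h₁ h₂ using 1
  ring

theorem prod_pow_sub_prod_pow_mem {ι : Type*} [Fintype ι] {M V : Ideal A} {w u : ι → A}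
    (hw : ∀ i, w i ∈ M) (hu : ∀ i, u i ∈ M) (hwu : ∀ i, w i - u i ∈ V) (e : ι → ℕ) :
    ∏ i, w i ^ e i - ∏ i, u i ^ e i ∈ V * M ^ (∑ i, e i - 1) := by
  classical
  have hpow : ∀ i k, w i ^ k - u i ^ k ∈ V * M ^ (k - 1) := by
    intro i k
    induction k with
    | zero => simp
    | succ k ih =>
      rw [pow_succ, pow_succ]
      refine mul_sub_mul_mem (Ideal.pow_mem_pow (hu i) k) ih (n := 1) ?_ ?_
      · simpa using hw i
      · simpa using hwu i
  have hprod : ∀ s : Finset ι,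
      ∏ i ∈ s, w i ^ e i - ∏ i ∈ s, u i ^ e i ∈ V * M ^ (∑ i ∈ s, e i - 1) := by
    intro s
    induction s using Finset.induction_on with
    | empty => simp
    | insert i s hi ih =>
      rw [Finset.prod_insert hi, Finset.prod_insert hi, Finset.sum_insert hi]
      refine mul_sub_mul_mem (Ideal.pow_mem_pow (hu i) _) (hpow i _) ?_ ih
      rw [← Finset.prod_pow_eq_pow_sum]
      exact Ideal.prod_mem_prod fun i _ => Ideal.pow_mem_pow (hw i) _
  exact hprod Finset.univ

theorem sup_pow_succ_le {M V T : Ideal A} (hV : V ≤ M) (hT : T ≤ M) (k : ℕ) :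
    (V ⊔ T) ^ (k + 1) ≤ V * M ^ k ⊔ T ^ (k + 1) := by
  induction k with
  | zero => simp
  | succ k ih =>
    rw [pow_succ]
    refine (Ideal.mul_mono_left ih).trans ?_
    rw [Ideal.sup_mul]
    refine sup_le ?_ ?_
    · rw [mul_assoc, pow_succ]
      exact (Ideal.mul_mono_right (Ideal.mul_mono_right (sup_le hV hT))).trans le_sup_left
    · rw [Ideal.mul_sup]
      refine sup_le (le_sup_of_le_left ?_) ?_
      · rw [mul_comm]
        exact Ideal.mul_mono_right (Ideal.pow_right_mono hT _)
      · rw [← pow_succ]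
        exact le_sup_right

theorem pow_add_eq_pow_mul_of_pow_succ_eq {M q : Ideal A} {s : ℕ} (h : M ^ (s + 1) = q * M ^ s)
    (k : ℕ) : M ^ (s + k) = q ^ k * M ^ s := by
  induction k with
  | zero => simp
  | succ k ih =>
    rw [← add_assoc, pow_succ, ih, mul_assoc, ← pow_succ, h, ← mul_assoc, ← pow_succ]

end Perturbation

section MinimalReduction
variable {R : Type} [CommRing R] [IsLocalRing R]

theorem pow_succ_eq_mul_pow_of_le_sup [IsNoetherianRing R] {W : Ideal R} {s : ℕ}
    (hW : W ≤ maximalIdeal R)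
    (h : maximalIdeal R ^ (s + 1) ≤ W * maximalIdeal R ^ s ⊔ maximalIdeal R ^ (s + 2)) :
    maximalIdeal R ^ (s + 1) = W * maximalIdeal R ^ s := by
  refine le_antisymm ?_ ?_
  · refine Submodule.le_of_le_smul_of_le_jacobson_bot (I := maximalIdeal R)
      (IsNoetherian.noetherian _) (maximalIdeal_le_jacobson _) ?_
    rwa [smul_eq_mul, ← pow_succ']
  · rw [pow_succ']
    exact Ideal.mul_mono_left hW

/-- A polynomial with a unit coefficient takes a unit value somewhere. -/
theorem exists_sum_mul_prod_pow_notMem [Infinite (ResidueField R)] {ι : Type*} [Fintype ι]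
    (T : Finset (ι → ℕ)) (r : (ι → ℕ) → R) {e₀ : ι → ℕ} (he₀ : e₀ ∈ T)
    (hr : r e₀ ∉ maximalIdeal R) :
    ∃ a : ι → R, ∑ e ∈ T, r e * ∏ i, a i ^ e i ∉ maximalIdeal R := by
  classical
  let p : MvPolynomial ι (ResidueField R) :=
    ∑ e ∈ T, MvPolynomial.monomial (Finsupp.equivFunOnFinite.symm e) (residue R (r e))
  have hp : p ≠ 0 := by
    intro h
    have h' := congrArg (MvPolynomial.coeff (Finsupp.equivFunOnFinite.symm e₀)) h
    simp only [p, MvPolynomial.coeff_sum, MvPolynomial.coeff_monomial, MvPolynomial.coeff_zero,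
      EmbeddingLike.apply_eq_iff_eq, Finset.sum_ite_eq', he₀, if_true] at h'
    exact hr ((residue_eq_zero_iff _).mp h')
  obtain ⟨x, hx⟩ : ∃ x, MvPolynomial.eval x p ≠ 0 := by
    by_contra! h
    exact hp (MvPolynomial.funext fun x => by rw [h x, map_zero])
  choose a ha using fun i => residue_surjective (R := R) (x i)
  refine ⟨a, fun h => hx ?_⟩
  rw [← residue_eq_zero_iff] at h
  rw [← h]
  simp only [p, map_sum, MvPolynomial.eval_monomial, map_mul, map_prod, map_pow, ha]
  refine Finset.sum_congr rfl fun e _ => ?_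
  rw [Finsupp.prod_fintype _ _ fun i => pow_zero _]
  simp

theorem exists_isReduction_card_lt [IsNoetherianRing R] [Infinite (ResidueField R)] {d : ℕ}
    (hd : (d : WithBot (WithTop ℕ)) = ringKrullDim R) {ι : Type*} [Fintype ι]
    (hι : d < Fintype.card ι) {w : ι → R}
    (hred : IsReduction (maximalIdeal R) (Ideal.span (Set.range w))) :
    ∃ S : Finset R, S.card < Fintype.card ι ∧ (S : Set R) ⊆ Ideal.span (Set.range w) ∧
      IsReduction (maximalIdeal R) (Ideal.span (S : Set R)) := by
  classical
  obtain ⟨hq, s, hs⟩ := hred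
  have hw : ∀ i, w i ∈ maximalIdeal R := fun i => hq (Ideal.subset_span ⟨i, rfl⟩)
  obtain ⟨n, T, r, hT, hrel, e₀, he₀, hr⟩ := exists_homogeneous_relation hd hι hw
  obtain ⟨a, ha⟩ := exists_sum_mul_prod_pow_notMem T r he₀ hr
  obtain _ | k := n
  · refine absurd ?_ ha
    have hz : ∀ e ∈ T, ∀ i, e i = 0 := fun e he i =>
      (Finset.sum_eq_zero_iff.mp (hT e he)) i (Finset.mem_univ i)
    have : ∑ e ∈ T, r e * ∏ i, a i ^ e i = ∑ e ∈ T, r e * ∏ i, w i ^ e i :=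
      Finset.sum_congr rfl fun e he => by simp [hz e he]
    rw [this]
    simpa using hrel
  obtain ⟨i₀, hi₀⟩ : ∃ i, a i ∉ maximalIdeal R := by
    by_contra! h
    refine ha (sum_mem fun e he => Ideal.mul_mem_left _ _ ?_)
    have := prod_pow_mem_pow h e
    rw [hT e he] at this
    exact Ideal.pow_le_self k.succ_ne_zero this
  obtain ⟨b, hb⟩ := (notMem_maximalIdeal.mp hi₀).exists_right_inv
  set t := b * w i₀ with ht
  have htm : t ∈ maximalIdeal R := Ideal.mul_mem_left _ _ (hw i₀)
  set v : ι → R := fun i => w i - a i * t with hv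
  have hv₀ : v i₀ = 0 := by
    simp only [hv, ht]
    rw [← mul_assoc, hb, one_mul, sub_self]
  let S : Finset R := (Finset.univ.erase i₀).image v
  have hSV : ∀ i, v i ∈ Ideal.span (S : Set R) := by
    intro i
    by_cases hi : i = i₀
    · rw [hi, hv₀]; exact zero_mem _
    · exact Ideal.subset_span (Finset.mem_coe.mpr
        (Finset.mem_image_of_mem _ (Finset.mem_erase.mpr ⟨hi, Finset.mem_univ _⟩)))
  have hSq : (S : Set R) ⊆ Ideal.span (Set.range w) := by
    intro x hx
    obtain ⟨i, -, rfl⟩ := Finset.mem_image.mp (Finset.mem_coe.mp hx)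
    exact sub_mem (Ideal.subset_span ⟨i, rfl⟩)
      (Ideal.mul_mem_left _ _ (Ideal.mul_mem_left _ _ (Ideal.subset_span ⟨i₀, rfl⟩)))
  have hVm : Ideal.span (S : Set R) ≤ maximalIdeal R := (Ideal.span_le.mpr hSq).trans hq
  set V := Ideal.span (S : Set R)
  have hqV : Ideal.span (Set.range w) ≤ V ⊔ Ideal.span {t} := by
    rw [Ideal.span_le]
    rintro _ ⟨i, rfl⟩
    have : w i = v i + a i * t := by simp [hv]
    rw [this]
    exact add_mem (Ideal.mem_sup_left (hSV i))
      (Ideal.mem_sup_right (Ideal.mul_mem_left _ _ (Ideal.mem_span_singleton_self t)))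
  have htk : t ^ (k + 1) ∈ V * maximalIdeal R ^ k ⊔ maximalIdeal R ^ (k + 2) := by
    have hu := (notMem_maximalIdeal.mp ha)
    have hdiff : ∑ e ∈ T, r e * ∏ i, w i ^ e i - ∑ e ∈ T, r e * ∏ i, (a i * t) ^ e i ∈
        V * maximalIdeal R ^ k := by
      rw [← Finset.sum_sub_distrib]
      refine sum_mem fun e he => ?_
      rw [← mul_sub]
      have := prod_pow_sub_prod_pow_mem (V := V) hw
        (fun i => Ideal.mul_mem_left _ (a i) htm) hSV e
      rw [hT e he] at this
      exact Ideal.mul_mem_left _ _ this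
    have heq : ∑ e ∈ T, r e * ∏ i, (a i * t) ^ e i =
        (∑ e ∈ T, r e * ∏ i, a i ^ e i) * t ^ (k + 1) := by
      rw [Finset.sum_mul]
      refine Finset.sum_congr rfl fun e he => ?_
      simp only [mul_pow, Finset.prod_mul_distrib, Finset.prod_pow_eq_pow_sum, hT e he, mul_assoc]
    rw [← Ideal.unit_mul_mem_iff_mem _ hu, ← heq]
    have h := sub_mem (Ideal.mem_sup_right (S := V * maximalIdeal R ^ k) hrel)
      (Ideal.mem_sup_left hdiff)
    rwa [sub_sub_cancel] at h
  refine ⟨S, ?_, hSq, hVm, s + k, pow_succ_eq_mul_pow_of_le_sup hVm ?_⟩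
  · refine Finset.card_image_le.trans_lt ?_
    exact Finset.card_lt_card (Finset.erase_ssubset (Finset.mem_univ i₀))
  · have h₁ : maximalIdeal R ^ (s + k + 1) ≤
        (V * maximalIdeal R ^ k ⊔ maximalIdeal R ^ (k + 2)) * maximalIdeal R ^ s := by
      rw [add_assoc, pow_add_eq_pow_mul_of_pow_succ_eq hs]
      refine Ideal.mul_mono_left ((Ideal.pow_right_mono hqV _).trans ?_)
      refine (sup_pow_succ_le hVm ((Ideal.span_singleton_le_iff_mem _).mpr htm) k).trans ?_
      refine sup_le le_sup_left ?_
      rw [Ideal.span_singleton_pow, Ideal.span_singleton_le_iff_mem]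
      exact htk
    refine h₁.trans_eq ?_
    rw [Ideal.sup_mul, mul_assoc, ← pow_add, ← pow_add]
    rw [add_comm k s, show k + 2 + s = s + k + 2 by ring]

theorem card_le_of_isReduction [IsNoetherianRing R] {d : ℕ}
    (hd : (d : WithBot (WithTop ℕ)) = ringKrullDim R) {S : Finset R}
    (hS : IsReduction (maximalIdeal R) (Ideal.span (S : Set R))) : d ≤ S.card := by
  obtain ⟨hm, s, hs⟩ := hS
  have hmin : maximalIdeal R ∈ (Ideal.span (S : Set R)).minimalPrimes := by
    refine ⟨⟨inferInstance, hm⟩, fun p ⟨hp, hSp⟩ _ => ?_⟩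
    refine hp.le_of_pow_le (n := s + 1) ?_
    rw [hs]
    exact Ideal.mul_le_left.trans hSp
  have h := Ideal.height_le_card_of_mem_minimalPrimes_span_finset hmin
  have h' : ((d : ℕ∞) : WithBot ℕ∞) = ((maximalIdeal R).height : WithBot ℕ∞) :=
    Eq.trans hd (maximalIdeal_height_eq_ringKrullDim (R := R)).symm
  rw [← WithBot.coe_injective h'] at h
  exact_mod_cast h

theorem exists_isReduction_fin [IsNoetherianRing R] [Infinite (ResidueField R)] {d : ℕ}
    (hd : (d : WithBot (WithTop ℕ)) = ringKrullDim R) {q : Ideal R}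
    (hq : IsReduction (maximalIdeal R) q) :
    ∃ z : Fin d → R, Ideal.span (Set.range z) ≤ q ∧
      IsReduction (maximalIdeal R) (Ideal.span (Set.range z)) := by
  classical
  have hex : ∃ n, ∃ S : Finset R, S.card = n ∧ (S : Set R) ⊆ q ∧
      IsReduction (maximalIdeal R) (Ideal.span (S : Set R)) := by
    obtain ⟨S, hS⟩ := IsNoetherian.noetherian q
    have hS' : Ideal.span (S : Set R) = q := hS
    exact ⟨_, S, rfl, hS' ▸ Ideal.subset_span, hS'.symm ▸ hq⟩
  obtain ⟨S, hcard, hSq, hS⟩ := Nat.find_spec hex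
  have hrange : Set.range ((↑) : S → R) = (S : Set R) := Subtype.range_coe
  have hle : S.card ≤ d := by
    by_contra! hlt
    obtain ⟨S', hlt', hS'q, hS'⟩ := exists_isReduction_card_lt hd (ι := S) (by simpa using hlt)
      (w := (↑)) (by rwa [hrange])
    rw [hrange] at hS'q
    rw [Fintype.card_coe, hcard] at hlt'
    exact Nat.find_min hex hlt' ⟨S', rfl, hS'q.trans (Ideal.span_le.mpr hSq), hS'⟩
  have heq : S.card = d := le_antisymm hle (card_le_of_isReduction hd hS)
  let e : Fin d ≃ S := (Fintype.equivFinOfCardEq (by simpa using heq)).symm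
  have hz : Set.range (fun i => (e i : R)) = S := by
    rw [← hrange]
    exact e.surjective.range_comp _
  exact ⟨fun i => e i, by rw [hz]; exact Ideal.span_le.mpr hSq, by rwa [hz]⟩

theorem not_le_span_sup_of_card_lt [IsNoetherianRing R] {d : ℕ}
    (hd : (d : WithBot (WithTop ℕ)) = ringKrullDim R) {q : Ideal R}
    (hq : IsReduction (maximalIdeal R) q) {S : Finset R} (hS : S.card < d)
    (hSm : (S : Set R) ⊆ maximalIdeal R) :
    ¬ q ≤ Ideal.span (S : Set R) ⊔ maximalIdeal R ^ 2 := by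
  intro h
  obtain ⟨-, s, hs⟩ := hq
  have hSm' := Ideal.span_le.mpr hSm
  refine hS.not_ge (card_le_of_isReduction hd ⟨hSm', s, pow_succ_eq_mul_pow_of_le_sup hSm' ?_⟩)
  rw [hs]
  refine (Ideal.mul_mono_left h).trans_eq ?_
  rw [Ideal.sup_mul, ← pow_add, add_comm 2 s]

theorem notMem_sq_of_isReduction [IsNoetherianRing R] {d : ℕ}
    (hd : (d : WithBot (WithTop ℕ)) = ringKrullDim R) {z : Fin d → R}
    (hz : IsReduction (maximalIdeal R) (Ideal.span (Set.range z))) (i : Fin d) :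
    z i ∉ maximalIdeal R ^ 2 := by
  classical
  intro hi
  refine not_le_span_sup_of_card_lt hd hz (S := (Finset.univ.erase i).image z) ?_ ?_ ?_
  · refine Finset.card_image_le.trans_lt ?_
    simpa using Finset.card_lt_card (Finset.erase_ssubset (Finset.mem_univ i))
  · intro x hx
    obtain ⟨j, -, rfl⟩ := Finset.mem_image.mp (Finset.mem_coe.mp hx)
    exact hz.1 (Ideal.subset_span ⟨j, rfl⟩)
  · rw [Ideal.span_le]
    rintro _ ⟨j, rfl⟩
    by_cases hj : j = i
    · rw [hj]; exact Ideal.mem_sup_right hi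
    · exact Ideal.mem_sup_left (Ideal.subset_span (Finset.mem_coe.mpr
        (Finset.mem_image_of_mem _ (Finset.mem_erase.mpr ⟨hj, Finset.mem_univ _⟩))))

/-- If `q` does not contain all of `z₁, …, z_d`, the residues of the coordinates of the combinations
of the `zᵢ` lying in `q` satisfy a nontrivial linear equation. -/
theorem exists_linear_relation_of_lt [IsNoetherianRing R] {d : ℕ} {z : Fin d → R} {q : Ideal R}
    (hq : ¬ Ideal.span (Set.range z) ≤ q) :
    ∃ (f : Fin d → R) (i₀ : Fin d), IsUnit (f i₀) ∧
      ∀ a : Fin d → R, ∑ i, a i * z i ∈ q → ∑ i, a i * f i ∈ maximalIdeal R := by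
  classical
  let L : Submodule (ResidueField R) (Fin d → ResidueField R) :=
    { carrier := {x | ∃ a : Fin d → R, (∀ i, residue R (a i) = x i) ∧ ∑ i, a i * z i ∈ q}
      zero_mem' := ⟨0, by simp, by simp⟩
      add_mem' := by
        rintro x y ⟨a, ha, haq⟩ ⟨b, hb, hbq⟩
        refine ⟨a + b, fun i => by simp [ha, hb], ?_⟩
        simpa [add_mul, Finset.sum_add_distrib] using add_mem haq hbq
      smul_mem' := by
        rintro c x ⟨a, ha, haq⟩
        obtain ⟨c, rfl⟩ := residue_surjective c
        refine ⟨c • a, fun i => by simp [ha], ?_⟩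
        simpa [mul_assoc, Finset.mul_sum] using q.mul_mem_left c haq }
  have hL : L < ⊤ := by
    rw [lt_top_iff_ne_top]
    intro htop
    refine hq (Submodule.le_of_le_smul_of_le_jacobson_bot (I := maximalIdeal R)
      (IsNoetherian.noetherian _) (maximalIdeal_le_jacobson _) ?_)
    rw [Ideal.span_le]
    rintro _ ⟨j, rfl⟩
    obtain ⟨a, ha, haq⟩ : Pi.single j 1 ∈ L := htop ▸ Submodule.mem_top
    have hz : z j = ∑ i, a i * z i + ∑ i, ((Pi.single j 1 : Fin d → R) i - a i) * z i := by
      rw [← Finset.sum_add_distrib]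
      simp [← add_mul, Pi.single_apply]
    rw [hz]
    refine add_mem (Ideal.mem_sup_left haq) (Ideal.mem_sup_right (sum_mem fun i _ => ?_))
    refine Ideal.mul_mem_mul ?_ (Ideal.subset_span ⟨i, rfl⟩)
    rw [← residue_eq_zero_iff, map_sub, ha, sub_eq_zero]
    by_cases h : i = j
    · subst h; simp
    · simp [h]
  obtain ⟨φ, hφ, hLφ⟩ := L.exists_le_ker_of_lt_top hL
  choose f hf using fun i => residue_surjective (R := R) (φ (Pi.single i 1))
  obtain ⟨i₀, hi₀⟩ : ∃ i, φ (Pi.single i 1) ≠ 0 := by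
    by_contra! h
    refine hφ (LinearMap.pi_ext' fun i => LinearMap.ext_ring ?_)
    simpa using h i
  refine ⟨f, i₀, ?_, fun a ha => ?_⟩
  · rw [← notMem_maximalIdeal, ← residue_eq_zero_iff, hf]
    exact hi₀
  · have hmem : (fun i => residue R (a i)) ∈ L := ⟨a, fun _ => rfl, ha⟩
    have h := LinearMap.mem_ker.mp (hLφ hmem)
    rw [φ.pi_apply_eq_sum_univ] at h
    rw [← residue_eq_zero_iff, map_sum, ← h]
    refine Finset.sum_congr rfl fun i _ => ?_
    rw [map_mul, hf, smul_eq_mul]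
    congr 2
    ext j
    simp [Pi.single_apply, eq_comm]

theorem isMinReduction_span_range [IsNoetherianRing R] {d : ℕ}
    (hd : (d : WithBot (WithTop ℕ)) = ringKrullDim R) {z : Fin d → R}
    (hz : IsReduction (maximalIdeal R) (Ideal.span (Set.range z))) :
    IsMinReduction (maximalIdeal R) (Ideal.span (Set.range z)) := by
  classical
  refine ⟨hz, fun q hqz hq => le_antisymm hqz ?_⟩
  by_contra hne
  obtain ⟨f, i₀, hu, hf⟩ := exists_linear_relation_of_lt hne
  obtain ⟨b, hb⟩ := hu.exists_right_inv
  have hzm : ∀ i, z i ∈ maximalIdeal R := fun i => hz.1 (Ideal.subset_span ⟨i, rfl⟩)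
  let v : Fin d → R := fun i => z i - f i * b * z i₀
  refine not_le_span_sup_of_card_lt hd hq (S := (Finset.univ.erase i₀).image v) ?_ ?_ ?_
  · refine Finset.card_image_le.trans_lt ?_
    simpa using Finset.card_lt_card (Finset.erase_ssubset (Finset.mem_univ i₀))
  · intro x hx
    obtain ⟨j, -, rfl⟩ := Finset.mem_image.mp (Finset.mem_coe.mp hx)
    exact sub_mem (hzm j) (Ideal.mul_mem_left _ _ (hzm i₀))
  · intro x hx
    obtain ⟨a, rfl⟩ := Ideal.mem_span_range_iff_exists_fun.mp (hqz hx)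
    have hsum : ∑ i, a i * z i = ∑ i, a i * v i + (∑ i, a i * f i) * (b * z i₀) := by
      rw [Finset.sum_mul, ← Finset.sum_add_distrib]
      refine Finset.sum_congr rfl fun i _ => ?_
      simp only [v]
      ring
    rw [hsum]
    refine add_mem (Ideal.mem_sup_left (sum_mem fun i _ => Ideal.mul_mem_left _ _ ?_))
      (Ideal.mem_sup_right ?_)
    · by_cases hi : i = i₀
      · have : v i = 0 := by
          simp only [v]
          rw [hi, hb, one_mul, sub_self]
        rw [this]
        exact zero_mem _
      · exact Ideal.subset_span (Finset.mem_coe.mpr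
          (Finset.mem_image_of_mem _ (Finset.mem_erase.mpr ⟨hi, Finset.mem_univ _⟩)))
    · rw [pow_two]
      exact Ideal.mul_mem_mul (hf a hx) (Ideal.mul_mem_left _ _ (hzm i₀))

/-- The condition `m ^ (s + 1) = q * m ^ s` on `q = (z₁, …, z_d)` is Zariski open. -/
theorem exists_polynomial_pow_succ_le [IsNoetherianRing R] {d N s : ℕ} {y : Fin N → R}
    (hy : Ideal.span (Set.range y) = maximalIdeal R) (c₀ : Fin d × Fin N → R)
    (h₀ : maximalIdeal R ^ (s + 1) =
      Ideal.span (Set.range fun i : Fin d => ∑ j, c₀ (i, j) * y j) * maximalIdeal R ^ s) :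
    ∃ P : MvPolynomial (Fin d × Fin N) (ResidueField R), P ≠ 0 ∧
      ∀ c : Fin d × Fin N → R, MvPolynomial.eval (fun p => residue R (c p)) P ≠ 0 →
        maximalIdeal R ^ (s + 1) ≤
          Ideal.span (Set.range fun i : Fin d => ∑ j, c (i, j) * y j) * maximalIdeal R ^ s := by
  classical
  obtain ⟨K, b, hb⟩ := Submodule.fg_iff_exists_fin_generating_family.mp
    (IsNoetherian.noetherian (maximalIdeal R ^ s))
  have hb : Ideal.span (Set.range b) = maximalIdeal R ^ s := hb
  have hbm : ∀ k, b k ∈ maximalIdeal R ^ s := fun k => hb ▸ Ideal.subset_span ⟨k, rfl⟩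
  have hym : ∀ j, y j ∈ maximalIdeal R := fun j => hy ▸ Ideal.subset_span ⟨j, rfl⟩
  let h : Fin d × Fin K → R := fun t => (∑ j, c₀ (t.1, j) * y j) * b t.2
  have hspan : maximalIdeal R ^ (s + 1) = Ideal.span (Set.range h) := by
    rw [h₀, ← hb, Ideal.span_mul_span']
    congr 1
    ext x
    simp [Set.mem_mul, h]
  have hα : ∀ (j : Fin N) (k : Fin K), ∃ α : Fin d × Fin K → R, ∑ t, α t * h t = y j * b k := by
    intro j k
    rw [← Ideal.mem_span_range_iff_exists_fun, ← hspan, pow_succ']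
    exact Ideal.mul_mem_mul (hym j) (hbm k)
  choose α hα using hα
  let B : (Fin d × Fin N → R) → Matrix (Fin d × Fin K) (Fin d × Fin K) R := fun c t u =>
    ∑ j, c (t.1, j) * α j t.2 u - ∑ j, c₀ (t.1, j) * α j t.2 u +
      (1 : Matrix (Fin d × Fin K) (Fin d × Fin K) R) t u
  let Q : Matrix (Fin d × Fin K) (Fin d × Fin K)
      (MvPolynomial (Fin d × Fin N) (ResidueField R)) := fun t u =>
    ∑ j, MvPolynomial.X (t.1, j) * MvPolynomial.C (residue R (α j t.2 u)) -
      MvPolynomial.C (residue R (∑ j, c₀ (t.1, j) * α j t.2 u)) +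
        (1 : Matrix (Fin d × Fin K) (Fin d × Fin K) _) t u
  have heval : ∀ c : Fin d × Fin N → R,
      MvPolynomial.eval (fun p => residue R (c p)) Q.det = residue R (B c).det := by
    intro c
    rw [RingHom.map_det, RingHom.map_det]
    congr 1
    ext t u
    rw [RingHom.mapMatrix_apply, RingHom.mapMatrix_apply, Matrix.map_apply, Matrix.map_apply]
    simp only [Q, B, map_add, map_sub, map_sum, map_mul,
      MvPolynomial.eval_X, MvPolynomial.eval_C, Matrix.one_apply]
    split_ifs <;> simp
  have hB₀ : B c₀ = 1 := by
    ext t u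
    simp [B]
  have hBh : ∀ (c : Fin d × Fin N → R) (t : Fin d × Fin K),
      (B c).mulVec h t = (∑ j, c (t.1, j) * y j) * b t.2 := by
    intro c t
    have haux : ∀ c : Fin d × Fin N → R, ∑ u, (∑ j, c (t.1, j) * α j t.2 u) * h u =
        (∑ j, c (t.1, j) * y j) * b t.2 := by
      intro c
      simp only [Finset.sum_mul]
      rw [Finset.sum_comm]
      refine Finset.sum_congr rfl fun j _ => ?_
      simp only [mul_assoc]
      rw [← Finset.mul_sum, hα]
    simp only [Matrix.mulVec, dotProduct, B, add_mul, sub_mul, Finset.sum_add_distrib,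
      Finset.sum_sub_distrib, haux]
    simp [Matrix.one_apply, h]
  refine ⟨Q.det, fun hQ => ?_, fun c hc => ?_⟩
  · have := heval c₀
    rw [hQ, hB₀] at this
    simp at this
  · rw [heval, Ne, residue_eq_zero_iff, notMem_maximalIdeal] at hc
    rw [hspan, Ideal.span_le]
    rintro _ ⟨t, rfl⟩
    have hinv : h = (B c)⁻¹.mulVec ((B c).mulVec h) := by
      rw [Matrix.mulVec_mulVec, Matrix.nonsing_inv_mul _ hc, Matrix.one_mulVec]
    rw [hinv]
    refine sum_mem fun u _ => Ideal.mul_mem_left _ _ ?_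
    rw [hBh]
    exact Ideal.mul_mem_mul (Ideal.subset_span ⟨u.1, rfl⟩) (hbm _)

end MinimalReduction

/-- Let `(R, m)` be a (Noetherian) local ring with infinite residue
field `κ` and `d = dim R`.  For a generic choice of elements `z₁, …, z_d ∈ m \ m²`,
the ideal `q = (z₁, …, z_d)` is a minimal reduction of `m` with `r_q(R) = r(R)`.
Genericity is expressed concretely: given any finite system of generators
`y₁, …, y_N` of `m`, there is a nonzero polynomial `P` over the residue field in the
coordinates of `d`-tuples such that every tuple `zᵢ = ∑ⱼ cᵢⱼ yⱼ` whose matrix of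
residues of coordinates does not annihilate `P` works. -/
theorem statement_2 {R : Type} [CommRing R] [IsLocalRing R] [IsNoetherianRing R]
    [Infinite (ResidueField R)] (d : ℕ)
    (hd : (d : WithBot (WithTop ℕ)) = ringKrullDim R)
    (N : ℕ) (y : Fin N → R) (hy : Ideal.span (Set.range y) = maximalIdeal R) :
    ∃ P : MvPolynomial (Fin d × Fin N) (ResidueField R), P ≠ 0 ∧
      ∀ c : Fin d × Fin N → R,
        MvPolynomial.eval (fun p => residue R (c p)) P ≠ 0 →
          (∀ i : Fin d, (∑ j, c (i, j) * y j) ∈ maximalIdeal R ∧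
              (∑ j, c (i, j) * y j) ∉ (maximalIdeal R) ^ 2) ∧
            IsMinReduction (maximalIdeal R)
              (Ideal.span (Set.range fun i : Fin d => ∑ j, c (i, j) * y j)) ∧
            redIdx (maximalIdeal R)
              (Ideal.span (Set.range fun i : Fin d => ∑ j, c (i, j) * y j))
              = locRedNum (maximalIdeal R) := by
  have hself : IsReduction (maximalIdeal R) (maximalIdeal R) := ⟨le_rfl, 0, by simp⟩
  obtain ⟨z₁, -, hz₁⟩ := exists_isReduction_fin hd hself
  obtain ⟨q, hq, hqs⟩ : locRedNum (maximalIdeal R) ∈ {s : ℕ | ∃ q : Ideal R,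
      IsMinReduction (maximalIdeal R) q ∧ redIdx (maximalIdeal R) q = s} :=
    Nat.sInf_mem ⟨_, _, isMinReduction_span_range hd hz₁, rfl⟩
  obtain ⟨z, hzq, hz⟩ := exists_isReduction_fin hd hq.1
  obtain rfl := hq.2 _ hzq hz
  have hs : maximalIdeal R ^ (locRedNum (maximalIdeal R) + 1) =
      Ideal.span (Set.range z) * maximalIdeal R ^ locRedNum (maximalIdeal R) := by
    rw [← hqs]
    exact Nat.sInf_mem hz.2
  have hzy : ∀ i, ∃ a : Fin N → R, ∑ j, a j * y j = z i := by
    intro i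
    rw [← Ideal.mem_span_range_iff_exists_fun, hy]
    exact hz.1 (Ideal.subset_span ⟨i, rfl⟩)
  choose a ha using hzy
  obtain rfl : (fun i => ∑ j, a i j * y j) = z := funext ha
  obtain ⟨P, hP, hPc⟩ := exists_polynomial_pow_succ_le hy (fun p => a p.1 p.2) hs
  refine ⟨P, hP, fun c hc => ?_⟩
  have hcm : ∀ i : Fin d, (∑ j, c (i, j) * y j) ∈ maximalIdeal R := fun i =>
    sum_mem fun j _ => Ideal.mul_mem_left _ _ (hy ▸ Ideal.subset_span ⟨j, rfl⟩)
  have hle : Ideal.span (Set.range fun i : Fin d => ∑ j, c (i, j) * y j) ≤ maximalIdeal R := by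
    rw [Ideal.span_le]
    rintro _ ⟨i, rfl⟩
    exact hcm i
  have heq : maximalIdeal R ^ (locRedNum (maximalIdeal R) + 1) =
      Ideal.span (Set.range fun i : Fin d => ∑ j, c (i, j) * y j) *
        maximalIdeal R ^ locRedNum (maximalIdeal R) := by
    refine le_antisymm (hPc c hc) ?_
    rw [pow_succ']
    exact Ideal.mul_mono_left hle
  have hred : IsReduction (maximalIdeal R)
      (Ideal.span (Set.range fun i : Fin d => ∑ j, c (i, j) * y j)) := ⟨hle, _, heq⟩
  have hmin := isMinReduction_span_range hd hred
  exact ⟨fun i => ⟨hcm i, notMem_sq_of_isReduction hd hred i⟩, hmin,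
    le_antisymm (Nat.sInf_le heq) (Nat.sInf_le ⟨_, hmin, rfl⟩)⟩
end

section
/- Let (R, m) be a local ring with infinite residue field and let {I_n} be a filtration of ideals of R with dim R/I_n = dim R/I_1 for all n ≥ 1. Then for all integers a, b ≥ 1, r(R/I_{a+b}) ≤ r(R/I_a) + r(R/I_b) + 1. -/
open CMReg IsLocalRing

section LocalRing

variable {A : Type} [CommRing A]

theorem sup_pow_succ_le_s3 (a b : Ideal A) (n : ℕ) :
    (a ⊔ b) ^ (n + 1) ≤ a * (a ⊔ b) ^ n ⊔ b ^ (n + 1) := by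
  induction n with
  | zero => simp
  | succ n ih =>
    calc (a ⊔ b) ^ (n + 1 + 1) = (a ⊔ b) * (a ⊔ b) ^ (n + 1) := pow_succ' _ _
      _ = a * (a ⊔ b) ^ (n + 1) ⊔ b * (a ⊔ b) ^ (n + 1) := Ideal.sup_mul _ _ _
      _ ≤ a * (a ⊔ b) ^ (n + 1) ⊔ b * (a * (a ⊔ b) ^ n ⊔ b ^ (n + 1)) := by gcongr
      _ = a * (a ⊔ b) ^ (n + 1) ⊔ (a * (b * (a ⊔ b) ^ n) ⊔ b ^ (n + 1 + 1)) := by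
        rw [Ideal.mul_sup, ← pow_succ', mul_left_comm]
      _ ≤ a * (a ⊔ b) ^ (n + 1) ⊔ (a * ((a ⊔ b) * (a ⊔ b) ^ n) ⊔ b ^ (n + 1 + 1)) := by
        gcongr
        exact le_sup_right
      _ = _ := by rw [← pow_succ', ← sup_assoc, sup_idem]

theorem multiset_prod_sub_prod_mem {ι : Type} (q p : Ideal A) (u w : ι → A)
    (hu : ∀ i, u i ∈ q) (hw : ∀ i, w i ∈ q) (huw : ∀ i, u i - w i ∈ p) (s : Multiset ι) :
    (s.map u).prod - (s.map w).prod ∈ p * q ^ (s.card - 1) := by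
  induction s using Multiset.induction with
  | empty => simp
  | cons a s ih =>
    have hcard : (s.map u).prod ∈ q ^ s.card := by
      clear ih
      induction s using Multiset.induction with
      | empty => simp
      | cons b s ih =>
        simp only [Multiset.map_cons, Multiset.prod_cons, Multiset.card_cons, pow_succ']
        exact Ideal.mul_mem_mul (hu b) ih
    simp only [Multiset.map_cons, Multiset.prod_cons, Multiset.card_cons, Nat.add_sub_cancel]
    have h : u a * (s.map u).prod - w a * (s.map w).prod
        = (u a - w a) * (s.map u).prod + w a * ((s.map u).prod - (s.map w).prod) := by ring
    rw [h]
    refine add_mem (Ideal.mul_mem_mul (huw a) hcard) ?_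
    rcases Multiset.empty_or_exists_mem s with rfl | ⟨b, hb⟩
    · simp
    · have hpos : 0 < s.card := Multiset.card_pos_iff_exists_mem.2 ⟨b, hb⟩
      have h2 : p * q ^ s.card = q * (p * q ^ (s.card - 1)) := by
        rw [mul_left_comm, ← pow_succ', Nat.sub_add_cancel hpos]
      rw [h2]
      exact Ideal.mul_mem_mul (hw a) ih

theorem sum_support_eq_of_isHomogeneous {ι : Type} {F : MvPolynomial ι A} {n : ℕ}
    (hF : F.IsHomogeneous n) {d : ι →₀ ℕ} (hd : d ∈ F.support) : ∑ i ∈ d.support, d i = n := by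
  have h := hF (MvPolynomial.mem_support_iff.1 hd)
  simpa [Finsupp.weight_apply, Finsupp.sum] using h

theorem eval_sub_eval_mem {ι : Type} (q p : Ideal A) (u w : ι → A)
    (hu : ∀ i, u i ∈ q) (hw : ∀ i, w i ∈ q) (huw : ∀ i, u i - w i ∈ p)
    {F : MvPolynomial ι A} {n : ℕ} (hF : F.IsHomogeneous n) :
    MvPolynomial.eval u F - MvPolynomial.eval w F ∈ p * q ^ (n - 1) := by
  have key : ∀ v : ι → A, MvPolynomial.eval v F
      = ∑ d ∈ F.support, F.coeff d * ((Finsupp.toMultiset d).map v).prod := by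
    intro v
    rw [MvPolynomial.eval_eq]
    refine Finset.sum_congr rfl fun d _ => ?_
    rw [Finsupp.toMultiset_map, Finsupp.prod_toMultiset, Finsupp.prod_mapDomain_index]
    · rfl
    · simp
    · intros; rw [pow_add]
  rw [key, key, ← Finset.sum_sub_distrib]
  refine Ideal.sum_mem _ fun d hd => ?_
  rw [← mul_sub]
  refine Ideal.mul_mem_left _ _ ?_
  have hn : (Finsupp.toMultiset d).card = n := by
    rw [Finsupp.card_toMultiset]
    exact sum_support_eq_of_isHomogeneous hF hd
  rw [← hn]
  exact multiset_prod_sub_prod_mem q p u w hu hw huw _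

theorem eval_mul_const {ι : Type} {F : MvPolynomial ι A} {n : ℕ} (hF : F.IsHomogeneous n)
    (e : ι → A) (x : A) :
    MvPolynomial.eval (fun i => e i * x) F = MvPolynomial.eval e F * x ^ n := by
  rw [MvPolynomial.eval_eq, MvPolynomial.eval_eq, Finset.sum_mul]
  refine Finset.sum_congr rfl fun d hd => ?_
  have hn := sum_support_eq_of_isHomogeneous hF hd
  simp only [mul_pow, Finset.prod_mul_distrib, Finset.prod_pow_eq_pow_sum, hn, mul_assoc]

theorem span_range_pow_eq {ι : Type} [Fintype ι] [DecidableEq ι] [DecidableEq A] (y : ι → A)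
    (n : ℕ) : Ideal.span (Set.range y) ^ n = Ideal.span
      ((Finset.finsuppAntidiag (Finset.univ : Finset ι) n).image
        fun d => d.prod fun i k => y i ^ k : Finset A) := by
  apply le_antisymm
  · intro a ha
    obtain ⟨p, hp, rfl⟩ := (Ideal.mem_span_pow_iff_exists_isHomogeneous y a).1 ha
    rw [MvPolynomial.eval_eq]
    refine Ideal.sum_mem _ fun d hd => Ideal.mul_mem_left _ _ (Ideal.subset_span ?_)
    have hn := sum_support_eq_of_isHomogeneous hp hd
    simp only [Finset.coe_image, Set.mem_image, Finset.mem_coe, Finset.mem_finsuppAntidiag']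
    exact ⟨d, ⟨hn, Finset.subset_univ _⟩, rfl⟩
  · rw [Ideal.span_le]
    intro a ha
    simp only [Finset.coe_image, Set.mem_image, Finset.mem_coe, Finset.mem_finsuppAntidiag'] at ha
    obtain ⟨d, ⟨hd, -⟩, rfl⟩ := ha
    refine (Ideal.mem_span_pow_iff_exists_isHomogeneous y _).2
      ⟨MvPolynomial.monomial d 1, MvPolynomial.isHomogeneous_monomial _ hd, ?_⟩
    rw [MvPolynomial.eval_monomial, one_mul]

theorem exists_mul_multichoose_lt (c l : ℕ) :
    ∃ n, c * l.multichoose n < (l + 1).multichoose n := by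
  have key : ∀ n, (l + 1).multichoose n * l = l.multichoose n * (n + l) := by
    intro n
    rcases Nat.eq_zero_or_pos l with rfl | hl
    · cases n <;> simp
    · obtain ⟨k, rfl⟩ := Nat.exists_eq_add_of_lt hl
      rw [Nat.multichoose_eq, Nat.multichoose_eq]
      have h := Nat.choose_mul_succ_eq (k + n) n
      rw [show k + n + 1 - n = k + 1 by omega] at h
      rw [show 0 + k + 1 + 1 + n - 1 = k + n + 1 by omega,
        show 0 + k + 1 + n - 1 = k + n by omega, show 0 + k + 1 = k + 1 by omega, ← h]
      ring
  rcases Nat.eq_zero_or_pos l with rfl | hl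
  · exact ⟨1, by simp⟩
  · refine ⟨c * l, ?_⟩
    have hpos : 0 < l.multichoose (c * l) := by
      rw [Nat.multichoose_eq]
      exact Nat.choose_pos (by omega)
    have h := key (c * l)
    refine lt_of_mul_lt_mul_right (a := l) ?_ (Nat.zero_le _)
    rw [h]
    nlinarith

theorem multichoose_mono {v w m n : ℕ} (h : v + 1 ≤ w) (hmn : m ≤ n) :
    (v + 1).multichoose m ≤ w.multichoose n := by
  rw [Nat.multichoose_eq, Nat.multichoose_eq]
  calc (v + 1 + m - 1).choose m = (v + m).choose v := by
        rw [show v + 1 + m - 1 = v + m by omega]; exact (Nat.choose_symm_add).symm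
    _ ≤ (v + n).choose v := Nat.choose_le_choose _ (by omega)
    _ = (v + n).choose n := Nat.choose_symm_add
    _ ≤ (w + n - 1).choose n := Nat.choose_le_choose _ (by omega)

theorem pow_add_eq_of_pow_succ_eq {M q : Ideal A} {s : ℕ} (h : M ^ (s + 1) = q * M ^ s) (n : ℕ) :
    M ^ (s + n) = q ^ n * M ^ s := by
  induction n with
  | zero => simp
  | succ n ih =>
    rw [← add_assoc, pow_succ, ih, mul_assoc, ← pow_succ, h, ← mul_assoc, ← pow_succ]

variable [IsLocalRing A]

theorem exists_relation_of_card_lt {ι : Type} [Fintype ι] (U : Finset A) (f : ι → A)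
    (hf : ∀ i, f i ∈ Ideal.span (U : Set A)) (hcard : U.card < Fintype.card ι) :
    ∃ c : ι → A, (∃ i, c i ∉ maximalIdeal A) ∧
      ∑ i, c i * f i ∈ maximalIdeal A * Ideal.span (U : Set A) := by
  classical
  have h1 : ∀ i, ∃ g : U → A, ∑ u, g u * (u : A) = f i := by
    intro i
    have := hf i
    rw [← Subtype.range_coe (s := (U : Set A))] at this
    exact Ideal.mem_span_range_iff_exists_fun.1 this
  choose g hg using h1
  let L : (ι → ResidueField A) →ₗ[ResidueField A] (U → ResidueField A) :=
    { toFun := fun a u => ∑ i, a i * residue A (g i u)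
      map_add' := by intro a b; ext u; simp [add_mul, Finset.sum_add_distrib]
      map_smul' := by intro a b; ext u; simp [Finset.mul_sum, mul_assoc] }
  have hker : LinearMap.ker L ≠ ⊥ := by
    apply LinearMap.ker_ne_bot_of_finrank_lt
    simpa using hcard
  obtain ⟨a, ha, ha0⟩ := Submodule.exists_mem_ne_zero_of_ne_bot hker
  choose c hc using fun i => residue_surjective (R := A) (a i)
  refine ⟨c, ?_, ?_⟩
  · by_contra! h
    refine ha0 (funext fun i => ?_)
    rw [← hc i]
    exact (residue_eq_zero_iff _).2 (h i)
  · have h2 : ∑ i, c i * f i = ∑ u : U, (∑ i, c i * g i u) * (u : A) := by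
      simp_rw [← hg, Finset.mul_sum, Finset.sum_mul]
      rw [Finset.sum_comm]
      simp_rw [mul_assoc]
    rw [h2]
    refine Ideal.sum_mem _ fun u _ => Ideal.mul_mem_mul ?_ (Ideal.subset_span u.2)
    rw [← residue_eq_zero_iff]
    have := congrFun (LinearMap.mem_ker.1 ha) u
    simpa [L, hc] using this

variable [IsNoetherianRing A]

theorem isReduction_of_pow_le {q : Ideal A} (hq : q ≤ maximalIdeal A) {s : ℕ}
    (h : maximalIdeal A ^ (s + 1) ≤ q * maximalIdeal A ^ s ⊔ maximalIdeal A ^ (s + 2)) :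
    maximalIdeal A ^ (s + 1) = q * maximalIdeal A ^ s := by
  apply le_antisymm
  · refine Submodule.le_of_le_smul_of_le_jacobson_bot (IsNoetherian.noetherian _)
      (maximalIdeal_le_jacobson _) (h.trans ?_)
    rw [smul_eq_mul, ← pow_succ']
  · rw [pow_succ']
    exact Ideal.mul_mono_left hq

theorem exists_reduction_of_relation [Infinite (ResidueField A)] {v : ℕ} (x : Fin v → A)
    (hq : IsReduction (maximalIdeal A) (Ideal.span (Set.range x))) {n : ℕ}
    (F : MvPolynomial (Fin v) A) (hF : F.IsHomogeneous (n + 1)) (d : Fin v →₀ ℕ)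
    (hd : F.coeff d ∉ maximalIdeal A) (hx : MvPolynomial.eval x F ∈ maximalIdeal A ^ (n + 2)) :
    ∃ w < v, ∃ y : Fin w → A, Ideal.span (Set.range y) ≤ Ideal.span (Set.range x) ∧
      IsReduction (maximalIdeal A) (Ideal.span (Set.range y)) := by
  set M := maximalIdeal A with hM
  set q := Ideal.span (Set.range x) with hqdef
  obtain ⟨hqM, s, hs⟩ := hq
  have hxq : ∀ i, x i ∈ q := fun i => Ideal.subset_span ⟨i, rfl⟩
  obtain ⟨cb, hcb⟩ : ∃ c, MvPolynomial.eval c (F.map (residue A)) ≠ 0 := by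
    by_contra! h
    have h0 := (hF.map (residue A)).eq_zero_of_forall_eval_eq_zero h
    have h1 := congrArg (MvPolynomial.coeff d) h0
    rw [MvPolynomial.coeff_map, MvPolynomial.coeff_zero] at h1
    exact hd ((residue_eq_zero_iff _).1 h1)
  choose c hc using fun i => residue_surjective (R := A) (cb i)
  have hcu : IsUnit (MvPolynomial.eval c F) := by
    rw [← notMem_maximalIdeal, ← residue_eq_zero_iff]
    rw [MvPolynomial.map_eval]
    rwa [← (funext hc : residue A ∘ c = cb)] at hcb
  obtain ⟨j, hj⟩ : ∃ j, IsUnit (c j) := by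
    by_contra! h
    have h1 : MvPolynomial.eval c F - MvPolynomial.eval (fun _ => 0) F ∈ M * M ^ (n + 1 - 1) :=
      eval_sub_eval_mem M M c (fun _ => 0) (fun i => h i) (fun _ => zero_mem _)
        (fun i => by rw [sub_zero]; exact h i) hF
    have h2 := eval_mul_const hF c 0
    simp only [mul_zero, zero_pow (Nat.succ_ne_zero n)] at h2
    rw [h2, sub_zero] at h1
    exact (Ideal.mul_le_left h1 : MvPolynomial.eval c F ∈ nonunits A) hcu
  obtain ⟨b, hb⟩ := hj.exists_right_inv
  obtain ⟨m, rfl⟩ : ∃ m, v = m + 1 := ⟨v - 1, by have := j.pos; omega⟩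
  set e : Fin (m + 1) → A := fun i => c i * b with he
  set x' : Fin (m + 1) → A := fun i => x i - e i * x j with hx'
  have hx'j : x' j = 0 := by simp [hx', he, hb]
  set p := Ideal.span (Set.range fun i => x' (j.succAbove i)) with hp
  have hx'p : ∀ i, x' i ∈ p := by
    intro i
    rcases Fin.eq_self_or_eq_succAbove j i with rfl | ⟨k, rfl⟩
    · rw [hx'j]; exact zero_mem _
    · exact Ideal.subset_span ⟨k, rfl⟩
  have hpq : p ≤ q := by
    rw [hp, Ideal.span_le]
    rintro _ ⟨k, rfl⟩
    exact sub_mem (hxq _) (Ideal.mul_mem_left _ _ (hxq _))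
  have hqp : q = p ⊔ Ideal.span {x j} := by
    apply le_antisymm
    · rw [hqdef, Ideal.span_le]
      rintro _ ⟨i, rfl⟩
      have h3 : x i = x' i + e i * x j := by simp [hx']
      rw [h3]
      exact add_mem (Ideal.mem_sup_left (hx'p i))
        (Ideal.mul_mem_left _ _ (Ideal.mem_sup_right (Ideal.mem_span_singleton_self _)))
    · refine sup_le hpq ?_
      rw [Ideal.span_singleton_le_iff_mem]
      exact hxq j
  have heu : IsUnit (MvPolynomial.eval e F) := by
    rw [he, eval_mul_const hF c b]
    exact hcu.mul ((IsUnit.of_mul_eq_one _ (by rw [mul_comm]; exact hb)).pow _)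
  have hxj : x j ^ (n + 1) ∈ p * q ^ n ⊔ M ^ (n + 2) := by
    have h4 := eval_sub_eval_mem q p x (fun i => e i * x j) hxq
      (fun i => Ideal.mul_mem_left _ _ (hxq j)) hx'p hF
    rw [eval_mul_const hF, Nat.add_sub_cancel] at h4
    have h5 : MvPolynomial.eval e F * x j ^ (n + 1) ∈ p * q ^ n ⊔ M ^ (n + 2) := by
      have h6 := sub_mem (Ideal.mem_sup_right hx : _ ∈ p * q ^ n ⊔ M ^ (n + 2))
        (Ideal.mem_sup_left h4)
      simpa using h6
    exact (Ideal.unit_mul_mem_iff_mem _ heu).1 h5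
  have hqn : q ^ (n + 1) ≤ p * q ^ n ⊔ M ^ (n + 2) := by
    have h7 := sup_pow_succ_le_s3 p (Ideal.span {x j}) n
    rw [← hqp] at h7
    refine h7.trans (sup_le le_sup_left ?_)
    rw [Ideal.span_singleton_pow, Ideal.span_singleton_le_iff_mem]
    exact hxj
  refine ⟨m, Nat.lt_succ_self m, fun i => x' (j.succAbove i), hpq, hpq.trans hqM, s + n, ?_⟩
  apply isReduction_of_pow_le (hpq.trans hqM)
  calc M ^ (s + n + 1) = q ^ (n + 1) * M ^ s := pow_add_eq_of_pow_succ_eq hs (n + 1)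
    _ ≤ (p * q ^ n ⊔ M ^ (n + 2)) * M ^ s := Ideal.mul_mono_left hqn
    _ = p * M ^ (s + n) ⊔ M ^ (s + n + 2) := by
      rw [Ideal.sup_mul, mul_assoc, ← pow_add_eq_of_pow_succ_eq hs n, ← pow_add,
        show n + 2 + s = s + n + 2 by omega]

theorem exists_relation_of_reduction {v l : ℕ} (h : l < v) (x : Fin v → A)
    (hx : ∀ i, x i ∈ maximalIdeal A) (y : Fin l → A)
    (hy : IsReduction (maximalIdeal A) (Ideal.span (Set.range y))) :
    ∃ (n : ℕ) (F : MvPolynomial (Fin v) A) (d : Fin v →₀ ℕ), F.IsHomogeneous (n + 1) ∧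
      F.coeff d ∉ maximalIdeal A ∧ MvPolynomial.eval x F ∈ maximalIdeal A ^ (n + 2) := by
  classical
  obtain ⟨hyM, s, hs⟩ := hy
  have hs' : maximalIdeal A ^ (s + 1 + 1)
      = Ideal.span (Set.range y) * maximalIdeal A ^ (s + 1) := by
    rw [pow_succ, hs, mul_assoc, ← pow_succ, hs]
  obtain ⟨T, hT⟩ := IsNoetherian.noetherian (maximalIdeal A ^ (s + 1))
  obtain ⟨n, hn⟩ := exists_mul_multichoose_lt T.card l
  set Y := (Finset.finsuppAntidiag (Finset.univ : Finset (Fin l)) n).image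
    fun d => d.prod fun i k => y i ^ k with hY
  have hYc : Y.card ≤ l.multichoose n := by
    refine Finset.card_image_le.trans ?_
    rw [Finset.card_finsuppAntidiag_nat_eq_multichoose, Finset.card_univ, Fintype.card_fin]
  set N := s + 1 + n with hN
  set S := Finset.finsuppAntidiag (Finset.univ : Finset (Fin v)) N with hS
  set U : Finset A := Finset.image₂ (· * ·) Y T with hU
  have hUspan : Ideal.span (U : Set A) = maximalIdeal A ^ N := by
    rw [hN, pow_add_eq_of_pow_succ_eq hs' n, ← hT, span_range_pow_eq]
    change _ = Ideal.span (Y : Set A) * Ideal.span (T : Set A)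
    rw [Ideal.span_mul_span', hU, Finset.coe_image₂]
    rfl
  have hUc : U.card < Fintype.card S := by
    rw [Fintype.card_coe, hS, Finset.card_finsuppAntidiag_nat_eq_multichoose, Finset.card_univ,
      Fintype.card_fin]
    calc U.card ≤ Y.card * T.card := Finset.card_image₂_le _ _ _
      _ ≤ l.multichoose n * T.card := Nat.mul_le_mul_right _ hYc
      _ = T.card * l.multichoose n := mul_comm _ _
      _ < (l + 1).multichoose n := hn
      _ ≤ v.multichoose N := multichoose_mono h (by omega)
  have hSsum : ∀ d : S, (d : Fin v →₀ ℕ).degree = N := fun d =>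
    (Finset.mem_finsuppAntidiag'.1 d.2).1
  have hmem : ∀ d : S, ((d : Fin v →₀ ℕ).prod fun i k => x i ^ k) ∈ Ideal.span (U : Set A) := by
    intro d
    rw [hUspan]
    refine Ideal.pow_right_mono (Ideal.span_le.2 (Set.range_subset_iff.2 hx)) N ?_
    rw [span_range_pow_eq]
    exact Ideal.subset_span (Finset.mem_coe.2 (Finset.mem_image_of_mem _ d.2))
  obtain ⟨c, ⟨d, hd⟩, hc⟩ := exists_relation_of_card_lt U _ hmem hUc
  refine ⟨s + n, ∑ d : S, MvPolynomial.monomial (d : Fin v →₀ ℕ) (c d), d, ?_, ?_, ?_⟩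
  · refine MvPolynomial.IsHomogeneous.sum _ _ _ fun d _ =>
      MvPolynomial.isHomogeneous_monomial _ ?_
    rw [hSsum, hN]; omega
  · rw [MvPolynomial.coeff_sum, Finset.sum_eq_single d]
    · simpa [MvPolynomial.coeff_monomial] using hd
    · intro e _ hne
      rw [MvPolynomial.coeff_monomial, if_neg]
      exact fun h => hne (Subtype.ext h)
    · simp
  · rw [hUspan, ← pow_succ'] at hc
    simp only [map_sum, MvPolynomial.eval_monomial]
    rwa [show s + n + 2 = N + 1 by omega]

theorem exists_generators_of_isMinReduction [Infinite (ResidueField A)] {q : Ideal A}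
    (hq : IsMinReduction (maximalIdeal A) q) :
    ∃ (v : ℕ) (x : Fin v → A), Ideal.span (Set.range x) = q ∧
      ∀ (w : ℕ) (y : Fin w → A), IsReduction (maximalIdeal A) (Ideal.span (Set.range y)) →
        v ≤ w := by
  classical
  have hex : ∃ (v : ℕ) (x : Fin v → A), Ideal.span (Set.range x) = q :=
    Submodule.fg_iff_exists_fin_generating_family.1 (IsNoetherian.noetherian q)
  obtain ⟨x, hx⟩ := Nat.find_spec hex
  refine ⟨Nat.find hex, x, hx, fun w y hy => ?_⟩
  by_contra! hlt
  have hxM : ∀ i, x i ∈ maximalIdeal A := fun i =>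
    hq.1.1 (hx ▸ Ideal.subset_span ⟨i, rfl⟩)
  obtain ⟨n, F, d, hF, hd, hFx⟩ := exists_relation_of_reduction hlt x hxM y hy
  obtain ⟨m, hm, z, hzq, hz⟩ := exists_reduction_of_relation x (hx.symm ▸ hq.1) F hF d hd hFx
  exact Nat.find_min hex hm ⟨z, hq.2 _ (hzq.trans hx.le) hz⟩

theorem isMinReduction_of_minimal_card {v : ℕ} (z : Fin v → A)
    (hz : IsReduction (maximalIdeal A) (Ideal.span (Set.range z)))
    (hmin : ∀ (w : ℕ) (y : Fin w → A),
      IsReduction (maximalIdeal A) (Ideal.span (Set.range y)) → v ≤ w) :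
    IsMinReduction (maximalIdeal A) (Ideal.span (Set.range z)) := by
  classical
  refine ⟨hz, fun q' hq' hred => le_antisymm hq' ?_⟩
  set M := maximalIdeal A with hM
  set q := Ideal.span (Set.range z) with hqdef
  obtain ⟨hq'M, s, hs⟩ := hred
  let T : Set (Fin v → ResidueField A) :=
    {a | ∃ c : Fin v → A, (∑ i, c i * z i ∈ q') ∧ ∀ i, residue A (c i) = a i}
  obtain ⟨b, hbT, hspan, hli⟩ := exists_linearIndependent (ResidueField A) T
  have hfin : Finite b := hli.finite
  obtain ⟨w, ⟨ε⟩⟩ := Finite.exists_equiv_fin b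
  choose c hcq hc using fun j : Fin w => hbT (ε.symm j).2
  set u : Fin w → A := fun j => ∑ i, c j i * z i with hu
  set p := Ideal.span (Set.range u) with hp
  have hpq' : p ≤ q' := Ideal.span_le.2 (Set.range_subset_iff.2 hcq)
  have key : ∀ a : Fin v → A, (fun i => residue A (a i)) ∈ Submodule.span (ResidueField A) b →
      ∑ i, a i * z i ∈ p ⊔ M * q := by
    intro a ha
    have hrange : b = Set.range fun j : Fin w => (ε.symm j : Fin v → ResidueField A) := by
      ext t
      constructor
      · intro ht
        exact ⟨ε ⟨t, ht⟩, by simp⟩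
      · rintro ⟨j, rfl⟩
        exact (ε.symm j).2
    rw [hrange] at ha
    obtain ⟨g, hg⟩ := (Submodule.mem_span_range_iff_exists_fun _).1 ha
    choose γ hγ using fun j => residue_surjective (R := A) (g j)
    have h1 : ∑ i, a i * z i
        = ∑ j, γ j * u j + ∑ i, (a i - ∑ j, γ j * c j i) * z i := by
      simp only [hu, sub_mul, Finset.sum_sub_distrib, Finset.mul_sum, Finset.sum_mul, mul_assoc]
      rw [Finset.sum_comm (s := Finset.univ (α := Fin w))]
      ring
    rw [h1]
    refine add_mem (Ideal.mem_sup_left (Ideal.sum_mem _ fun j _ =>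
      Ideal.mul_mem_left _ _ (Ideal.subset_span ⟨j, rfl⟩))) (Ideal.mem_sup_right
      (Ideal.sum_mem _ fun i _ => Ideal.mul_mem_mul ?_ (Ideal.subset_span ⟨i, rfl⟩)))
    rw [hM, ← residue_eq_zero_iff, map_sub, map_sum, sub_eq_zero]
    have h2 := congrFun hg i
    simp only [Finset.sum_apply, Pi.smul_apply, smul_eq_mul] at h2
    rw [← h2]
    simp [hγ, hc]
  have hfg : ∀ a ∈ q, ∃ g : Fin v → A, ∑ i, g i * z i = a := fun a ha =>
    Ideal.mem_span_range_iff_exists_fun.1 ha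
  have hredp : IsReduction M p := by
    refine ⟨hpq'.trans hq'M, s, isReduction_of_pow_le (hpq'.trans hq'M) ?_⟩
    have hq'p : q' ≤ p ⊔ M * q := by
      intro a ha
      obtain ⟨g, rfl⟩ := hfg a (hq' ha)
      refine key g ?_
      rw [hspan]
      exact Submodule.subset_span ⟨g, ha, fun _ => rfl⟩
    calc M ^ (s + 1) = q' * M ^ s := hs
      _ ≤ (p ⊔ M * M) * M ^ s :=
        Ideal.mul_mono_left (hq'p.trans (sup_le_sup_left (Ideal.mul_mono_right hz.1) _))
      _ = p * M ^ s ⊔ M ^ (s + 2) := by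
        rw [Ideal.sup_mul]; congr 1; ring
  have htop : Submodule.span (ResidueField A) b = ⊤ := by
    apply Submodule.eq_top_of_finrank_eq
    have : Fintype b := Fintype.ofFinite b
    have h1 : Module.finrank (ResidueField A) (Submodule.span (ResidueField A) b) = w := by
      rw [finrank_span_set_eq_card hli, Set.toFinset_card, Fintype.card_congr ε, Fintype.card_fin]
    refine le_antisymm (Submodule.finrank_le _) ?_
    rw [h1, Module.finrank_fin_fun]
    exact hmin w u hredp
  refine Submodule.le_of_le_smul_of_le_jacobson_bot (I := M) (IsNoetherian.noetherian _)
    (maximalIdeal_le_jacobson _) ?_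
  intro a ha
  obtain ⟨g, rfl⟩ := hfg a ha
  exact sup_le_sup_right hpq' _ (key g (htop ▸ Submodule.mem_top))

theorem exists_isMinReduction : ∃ q, IsMinReduction (maximalIdeal A) q := by
  classical
  have hex : ∃ (v : ℕ) (x : Fin v → A),
      IsReduction (maximalIdeal A) (Ideal.span (Set.range x)) := by
    obtain ⟨v, x, hx⟩ := Submodule.fg_iff_exists_fin_generating_family.1
      (IsNoetherian.noetherian (maximalIdeal A))
    have hx' : Ideal.span (Set.range x) = maximalIdeal A := hx
    exact ⟨v, x, hx'.le, 0, by rw [hx']; simp⟩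
  obtain ⟨x, hx⟩ := Nat.find_spec hex
  exact ⟨_, isMinReduction_of_minimal_card x hx fun w y hy => Nat.find_min' hex ⟨y, hy⟩⟩

theorem exists_isMinReduction_pow_succ_eq : ∃ q, IsMinReduction (maximalIdeal A) q ∧
    maximalIdeal A ^ (locRedNum (maximalIdeal A) + 1)
      = q * maximalIdeal A ^ locRedNum (maximalIdeal A) := by
  obtain ⟨q, hq⟩ := exists_isMinReduction (A := A)
  obtain ⟨q, hq, h⟩ := Nat.sInf_mem
    (s := {s : ℕ | ∃ q : Ideal A, IsMinReduction (maximalIdeal A) q ∧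
      redIdx (maximalIdeal A) q = s}) ⟨_, q, hq, rfl⟩
  refine ⟨q, hq, ?_⟩
  have h2 : redIdx (maximalIdeal A) q = locRedNum (maximalIdeal A) := h
  rw [← h2]
  exact Nat.sInf_mem hq.1.2

end LocalRing

section Quotient

variable {R : Type} [CommRing R]

theorem pow_succ_le_sup_mul {m q J K : Ideal R} {s t : ℕ}
    (hJ : m ^ (s + 1) ≤ q * m ^ s ⊔ J) (hK : m ^ (t + 1) ≤ q * m ^ t ⊔ K) (hq : q ≤ m) :
    m ^ (s + t + 1 + 1) ≤ q * m ^ (s + t + 1) ⊔ J * K := by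
  have hJ' : m ^ (s + 1) ≤ q * m ^ s ⊔ m ^ (s + 1) ⊓ J := by
    have hle : q * m ^ s ≤ m ^ (s + 1) := by
      rw [pow_succ']; exact Ideal.mul_mono_left hq
    rw [inf_comm, ← sup_inf_assoc_of_le _ hle]
    exact le_inf hJ le_rfl
  calc m ^ (s + t + 1 + 1) = m ^ (s + 1) * m ^ (t + 1) := by rw [← pow_add]; congr 1; omega
    _ ≤ (q * m ^ s ⊔ m ^ (s + 1) ⊓ J) * m ^ (t + 1) := Ideal.mul_mono_left hJ'
    _ = q * m ^ (s + t + 1) ⊔ (m ^ (s + 1) ⊓ J) * m ^ (t + 1) := by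
      rw [Ideal.sup_mul, mul_assoc, ← pow_add, ← add_assoc]
    _ ≤ q * m ^ (s + t + 1) ⊔ (m ^ (s + 1) ⊓ J) * (q * m ^ t ⊔ K) := by gcongr
    _ = q * m ^ (s + t + 1) ⊔
        ((m ^ (s + 1) ⊓ J) * (q * m ^ t) ⊔ (m ^ (s + 1) ⊓ J) * K) := by rw [Ideal.mul_sup]
    _ ≤ q * m ^ (s + t + 1) ⊔ (q * m ^ (s + t + 1) ⊔ J * K) := by
      refine sup_le_sup_left (sup_le_sup ?_ (Ideal.mul_mono_left inf_le_right)) _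
      calc (m ^ (s + 1) ⊓ J) * (q * m ^ t) ≤ m ^ (s + 1) * (q * m ^ t) :=
            Ideal.mul_mono_left inf_le_left
        _ = q * m ^ (s + t + 1) := by
          rw [mul_left_comm, ← pow_add, show s + 1 + t = s + t + 1 by omega]
    _ = _ := by rw [← sup_assoc, sup_idem]

theorem exists_pow_succ_le_sup_pow {m q J : Ideal R} {s : ℕ}
    (h : m ^ (s + 1) ≤ q * m ^ s ⊔ J) (hq : q ≤ m) (n : ℕ) :
    ∃ t, m ^ (t + 1) ≤ q * m ^ t ⊔ J ^ (n + 1) := by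
  induction n with
  | zero => exact ⟨s, by simpa using h⟩
  | succ n ih =>
    obtain ⟨t, ht⟩ := ih
    refine ⟨t + s + 1, ?_⟩
    rw [pow_succ J (n + 1)]
    exact pow_succ_le_sup_mul ht h hq

theorem map_pow_le_map_mul_iff (m q J : Ideal R) (s : ℕ) :
    m.map (Ideal.Quotient.mk J) ^ (s + 1)
      ≤ q.map (Ideal.Quotient.mk J) * m.map (Ideal.Quotient.mk J) ^ s
      ↔ m ^ (s + 1) ≤ q * m ^ s ⊔ J := by
  rw [← Ideal.map_pow, ← Ideal.map_pow, ← Ideal.map_mul, Ideal.map_le_iff_le_comap,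
    Ideal.comap_map_quotientMk, sup_comm]

theorem map_mk_span_range {ι : Type} (J : Ideal R) (y : ι → R) :
    (Ideal.span (Set.range y)).map (Ideal.Quotient.mk J)
      = Ideal.span (Set.range fun i => Ideal.Quotient.mk J (y i)) := by
  rw [Ideal.map_span, ← Set.range_comp]
  rfl

theorem exists_perturbation_of_mem {m : Ideal R} {v : ℕ} (x δ : Fin v → R)
    (hδ : ∀ i, δ i ∈ m) (r : ℕ) {a : R} (ha : a ∈ Ideal.span (Set.range x) * m ^ r) :
    ∃ a' ∈ m ^ (r + 1), ∀ t : R,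
      a + t * a' ∈ Ideal.span (Set.range fun i => x i + t * δ i) * m ^ r := by
  induction ha using Submodule.mul_induction_on' with
  | mem_mul_mem c hc b hb =>
    obtain ⟨g, rfl⟩ := Ideal.mem_span_range_iff_exists_fun.1 hc
    refine ⟨(∑ i, g i * δ i) * b, ?_, fun t => ?_⟩
    · rw [pow_succ']
      exact Ideal.mul_mem_mul (Ideal.sum_mem _ fun i _ => Ideal.mul_mem_left _ _ (hδ i)) hb
    · have h : (∑ i, g i * x i) * b + t * ((∑ i, g i * δ i) * b)
          = (∑ i, g i * (x i + t * δ i)) * b := by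
        simp only [mul_add, Finset.sum_add_distrib, add_mul, ← mul_assoc, Finset.mul_sum]
        simp only [mul_comm t]
      rw [h]
      exact Ideal.mul_mem_mul (Ideal.sum_mem _ fun i _ =>
        Ideal.mul_mem_left _ _ (Ideal.subset_span ⟨i, rfl⟩)) hb
  | add c _ d _ hc hd =>
    obtain ⟨c', hc', hc⟩ := hc
    obtain ⟨d', hd', hd⟩ := hd
    refine ⟨c' + d', add_mem hc' hd', fun t => ?_⟩
    convert add_mem (hc t) (hd t) using 1
    ring

open Polynomial in
theorem exists_polynomial_perturbation [IsNoetherianRing R] {m J : Ideal R} {v : ℕ}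
    (x δ : Fin v → R) (hδ : ∀ i, δ i ∈ m) {r : ℕ}
    (h : m ^ (r + 1) ≤ Ideal.span (Set.range x) * m ^ r ⊔ J) :
    ∃ p : R[X], p.eval 0 = 1 ∧ ∀ t : R, IsUnit (p.eval t) →
      m ^ (r + 1) ≤ Ideal.span (Set.range fun i => x i + t * δ i) * m ^ r ⊔ J := by
  obtain ⟨N, g, hg⟩ := Submodule.fg_iff_exists_fin_generating_family.1
    (IsNoetherian.noetherian (m ^ (r + 1)))
  have hg' : Ideal.span (Set.range g) = m ^ (r + 1) := hg
  have h1 : ∀ i, ∃ c : Fin N → R, ∀ t : R, g i + t * ∑ k, c k * g k ∈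
      Ideal.span (Set.range fun i => x i + t * δ i) * m ^ r ⊔ J := by
    intro i
    obtain ⟨a, ha, j, hj, haj⟩ := Submodule.mem_sup.1
      (h (hg' ▸ Ideal.subset_span ⟨i, rfl⟩ : g i ∈ m ^ (r + 1)))
    obtain ⟨a', ha', hat⟩ := exists_perturbation_of_mem x δ hδ r ha
    rw [← hg'] at ha'
    obtain ⟨c, hc⟩ := Ideal.mem_span_range_iff_exists_fun.1 ha'
    refine ⟨c, fun t => ?_⟩
    rw [hc, ← haj, add_right_comm]
    exact add_mem (Ideal.mem_sup_left (hat t)) (Ideal.mem_sup_right hj)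
  choose c hc using h1
  let C : Matrix (Fin N) (Fin N) R := Matrix.of c
  have heval : ∀ t : R, (1 + (X : R[X]) • C.map Polynomial.C).det.eval t = (1 + t • C).det := by
    intro t
    rw [← coe_evalRingHom, RingHom.map_det]
    congr 1
    ext i j
    simpa [Matrix.one_apply, apply_ite (eval t)] using mul_comm (C i j) t
  refine ⟨(1 + (X : R[X]) • C.map Polynomial.C).det, by simp [heval], fun t ht => ?_⟩
  rw [heval] at ht
  rw [← hg', Ideal.span_le]
  rintro _ ⟨i, rfl⟩
  refine (Ideal.unit_mul_mem_iff_mem _ ht).1 ?_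
  have h2 : (1 + t • C).det • g = (1 + t • C).adjugate.mulVec ((1 + t • C).mulVec g) := by
    rw [Matrix.mulVec_mulVec, Matrix.adjugate_mul, Matrix.smul_mulVec, Matrix.one_mulVec]
  have h3 : (1 + t • C).det * g i = ∑ k, (1 + t • C).adjugate i k *
      (g k + t * ∑ l, c k l * g l) := by
    have := congrFun h2 i
    simp only [Pi.smul_apply, smul_eq_mul] at this
    rw [this, Matrix.mulVec, dotProduct]
    refine Finset.sum_congr rfl fun k _ => ?_
    rw [Matrix.add_mulVec, Matrix.one_mulVec, Matrix.smul_mulVec]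
    rfl
  rw [h3]
  exact Ideal.sum_mem _ fun k _ => Ideal.mul_mem_left _ _ (hc k t)

variable [IsLocalRing R]

theorem mem_maximalIdeal_of_mk_mem {J : Ideal R} [IsLocalRing (R ⧸ J)] {a : R}
    (h : Ideal.Quotient.mk J a ∈ maximalIdeal (R ⧸ J)) : a ∈ maximalIdeal R :=
  fun ha => h (ha.map (Ideal.Quotient.mk J))

variable [IsNoetherianRing R]

theorem exists_generators_of_quotient [Infinite (ResidueField R)] {J : Ideal R} (hJ : J ≠ ⊤) :
    ∃ (v : ℕ) (x : Fin v → R), (∀ i, x i ∈ maximalIdeal R) ∧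
      maximalIdeal R ^ (locRedNum ((maximalIdeal R).map (Ideal.Quotient.mk J)) + 1) ≤
        Ideal.span (Set.range x) *
          maximalIdeal R ^ locRedNum ((maximalIdeal R).map (Ideal.Quotient.mk J)) ⊔ J ∧
      ∀ (w : ℕ) (y : Fin w → R) (s : ℕ), (∀ i, y i ∈ maximalIdeal R) →
        maximalIdeal R ^ (s + 1) ≤ Ideal.span (Set.range y) * maximalIdeal R ^ s ⊔ J → v ≤ w := by
  have : Nontrivial (R ⧸ J) := Ideal.Quotient.nontrivial_iff.2 hJ
  have : IsLocalRing (R ⧸ J) := .of_surjective' _ Ideal.Quotient.mk_surjective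
  have : IsLocalHom (Ideal.Quotient.mk J) :=
    .of_surjective _ Ideal.Quotient.mk_surjective
  have : Infinite (ResidueField (R ⧸ J)) :=
    Infinite.of_injective (ResidueField.map (Ideal.Quotient.mk J)) (RingHom.injective _)
  have hM := (map_maximalIdeal_of_surjective (Ideal.Quotient.mk J)
    Ideal.Quotient.mk_surjective).symm
  obtain ⟨q, hq, hqr⟩ := exists_isMinReduction_pow_succ_eq (A := R ⧸ J)
  obtain ⟨v, xb, hxb, hmin⟩ := exists_generators_of_isMinReduction hq
  choose x hx using fun i => Ideal.Quotient.mk_surjective (xb i)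
  refine ⟨v, x, fun i => mem_maximalIdeal_of_mk_mem (J := J) ?_, ?_, fun w y s hy hs => ?_⟩
  · rw [hx]
    exact hq.1.1 (hxb ▸ Ideal.subset_span ⟨i, rfl⟩)
  · rw [← map_pow_le_map_mul_iff, ← hM, map_mk_span_range, funext hx, hxb]
    exact hqr.le
  · rw [← map_pow_le_map_mul_iff, ← hM, map_mk_span_range] at hs
    have hle : Ideal.span (Set.range fun i => Ideal.Quotient.mk J (y i))
        ≤ maximalIdeal (R ⧸ J) := by
      rw [← map_mk_span_range, hM]
      exact Ideal.map_mono (Ideal.span_le.2 (Set.range_subset_iff.2 hy))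
    refine hmin w _ ⟨hle, s, le_antisymm hs ?_⟩
    rw [pow_succ']
    exact Ideal.mul_mono_left hle

theorem locRedNum_quotient_le {J : Ideal R} (hJ : J ≠ ⊤) {v : ℕ} (z : Fin v → R) {s : ℕ}
    (hz : ∀ i, z i ∈ maximalIdeal R)
    (hs : maximalIdeal R ^ (s + 1) ≤ Ideal.span (Set.range z) * maximalIdeal R ^ s ⊔ J)
    (hmin : ∀ (w : ℕ) (y : Fin w → R) (s : ℕ), (∀ i, y i ∈ maximalIdeal R) →
      maximalIdeal R ^ (s + 1) ≤ Ideal.span (Set.range y) * maximalIdeal R ^ s ⊔ J → v ≤ w) :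
    locRedNum ((maximalIdeal R).map (Ideal.Quotient.mk J)) ≤ s := by
  have : Nontrivial (R ⧸ J) := Ideal.Quotient.nontrivial_iff.2 hJ
  have : IsLocalRing (R ⧸ J) := .of_surjective' _ Ideal.Quotient.mk_surjective
  have hM := (map_maximalIdeal_of_surjective (Ideal.Quotient.mk J)
    Ideal.Quotient.mk_surjective).symm
  rw [← map_pow_le_map_mul_iff, ← hM, map_mk_span_range] at hs
  rw [← hM]
  set q := Ideal.span (Set.range fun i => Ideal.Quotient.mk J (z i)) with hq
  have hle : q ≤ maximalIdeal (R ⧸ J) := by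
    rw [hq, ← map_mk_span_range, hM]
    exact Ideal.map_mono (Ideal.span_le.2 (Set.range_subset_iff.2 hz))
  have heq : maximalIdeal (R ⧸ J) ^ (s + 1) = q * maximalIdeal (R ⧸ J) ^ s := by
    refine le_antisymm hs ?_
    rw [pow_succ']
    exact Ideal.mul_mono_left hle
  have hqmin : IsMinReduction (maximalIdeal (R ⧸ J)) q := by
    refine isMinReduction_of_minimal_card _ ⟨hle, s, heq⟩ fun w yb hy => ?_
    choose y hyy using fun i => Ideal.Quotient.mk_surjective (yb i)
    obtain ⟨hyM, k, hk⟩ := hy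
    refine hmin w y k (fun i => mem_maximalIdeal_of_mk_mem (J := J) ?_) ?_
    · rw [hyy]
      exact hyM (Ideal.subset_span ⟨i, rfl⟩)
    · rw [← map_pow_le_map_mul_iff, ← hM, map_mk_span_range, funext hyy]
      exact hk.le
  calc locRedNum (maximalIdeal (R ⧸ J)) ≤ redIdx (maximalIdeal (R ⧸ J)) q :=
        Nat.sInf_le ⟨q, hqmin, rfl⟩
    _ ≤ s := Nat.sInf_le heq

open Polynomial in
theorem exists_common_generators [Infinite (ResidueField R)] {J K : Ideal R} {v : ℕ}
    (x y : Fin v → R) (hx : ∀ i, x i ∈ maximalIdeal R) (hy : ∀ i, y i ∈ maximalIdeal R) {r s : ℕ}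
    (hJ : maximalIdeal R ^ (r + 1) ≤ Ideal.span (Set.range x) * maximalIdeal R ^ r ⊔ J)
    (hK : maximalIdeal R ^ (s + 1) ≤ Ideal.span (Set.range y) * maximalIdeal R ^ s ⊔ K) :
    ∃ z : Fin v → R, (∀ i, z i ∈ maximalIdeal R) ∧
      maximalIdeal R ^ (r + 1) ≤ Ideal.span (Set.range z) * maximalIdeal R ^ r ⊔ J ∧
      maximalIdeal R ^ (s + 1) ≤ Ideal.span (Set.range z) * maximalIdeal R ^ s ⊔ K := by
  obtain ⟨p, hp0, hp⟩ := exists_polynomial_perturbation x (fun i => y i - x i)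
    (fun i => sub_mem (hy i) (hx i)) hJ
  obtain ⟨p', hp'0, hp'⟩ := exists_polynomial_perturbation y (fun i => x i - y i)
    (fun i => sub_mem (hx i) (hy i)) hK
  have hne : p.map (residue R) * (p'.comp (1 - X)).map (residue R) ≠ 0 := by
    refine mul_ne_zero (fun h => ?_) (fun h => ?_)
    · have := congrArg (eval (residue R 0)) h
      rw [eval_map_apply, hp0] at this
      simp at this
    · have := congrArg (eval (residue R 1)) h
      rw [eval_map_apply] at this
      simp [eval_comp, hp'0] at this
  obtain ⟨tb, htb⟩ : ∃ tb, (p.map (residue R) * (p'.comp (1 - X)).map (residue R)).eval tb ≠ 0 := by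
    by_contra! h
    exact hne (Polynomial.funext (by simpa using h))
  obtain ⟨t, rfl⟩ := residue_surjective tb
  rw [eval_mul, eval_map_apply, eval_map_apply, ← map_mul, Ne, residue_eq_zero_iff,
    notMem_maximalIdeal, IsUnit.mul_iff, eval_comp] at htb
  refine ⟨fun i => x i + t * (y i - x i), fun i =>
    add_mem (hx i) (Ideal.mul_mem_left _ _ (sub_mem (hy i) (hx i))), hp t htb.1, ?_⟩
  have h := hp' (1 - t) (by simpa using htb.2)
  convert h using 5
  ext i
  ring

end Quotient

/-- Let `(R, m)` be a (Noetherian) local ring with infinite residue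
field and let `{Iₙ}` be a filtration of ideals of `R` with `dim R/Iₙ = dim R/I₁` for
all `n ≥ 1`.  Then for all `a, b ≥ 1`,
`r(R/I_{a+b}) ≤ r(R/I_a) + r(R/I_b) + 1`, where the reduction number of `R/J` is
taken with respect to its maximal ideal `m/J`. -/
theorem statement_3 {R : Type} [CommRing R] [IsLocalRing R] [IsNoetherianRing R]
    [Infinite (ResidueField R)] (I : ℕ → Ideal R)
    (hI0 : I 0 = ⊤) (hdec : ∀ n, I (n + 1) ≤ I n)
    (hfil : ∀ a b, I a * I b ≤ I (a + b))
    (hdim : ∀ n ≥ 1, ringKrullDim (R ⧸ I n) = ringKrullDim (R ⧸ I 1))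
    (a b : ℕ) (ha : 1 ≤ a) (hb : 1 ≤ b) :
    locRedNum ((maximalIdeal R).map (Ideal.Quotient.mk (I (a + b))))
      ≤ locRedNum ((maximalIdeal R).map (Ideal.Quotient.mk (I a)))
        + locRedNum ((maximalIdeal R).map (Ideal.Quotient.mk (I b))) + 1 := by
  have hanti : Antitone I := antitone_nat_of_succ_le hdec
  have hpow : ∀ c n, I c ^ (n + 1) ≤ I (c * (n + 1)) := by
    intro c n
    induction n with
    | zero => simp
    | succ n ih =>
      calc I c ^ (n + 1 + 1) = I c ^ (n + 1) * I c := pow_succ _ _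
        _ ≤ I (c * (n + 1)) * I c := Ideal.mul_mono_left ih
        _ ≤ I (c * (n + 1 + 1)) := hfil _ _
  have hpow' : ∀ c d, 1 ≤ c → ∃ n, I c ^ (n + 1) ≤ I d := fun c d hc =>
    ⟨d, (hpow c d).trans (hanti (by nlinarith))⟩
  by_cases htop : I (a + b) = ⊤
  · have hsub : Subsingleton (R ⧸ I (a + b)) := Ideal.Quotient.subsingleton_iff.2 htop
    refine le_trans (Nat.sInf_le (m := 0) ?_) (Nat.zero_le _)
    refine ⟨⊤, ⟨⟨(Subsingleton.elim _ _ : _ = _).le, 0, Subsingleton.elim _ _⟩,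
      fun _ _ _ => Subsingleton.elim _ _⟩, Nat.le_zero.1 (Nat.sInf_le (Subsingleton.elim _ _))⟩
  have hne : ∀ c, 1 ≤ c → I c ≠ ⊤ := by
    intro c hc h
    obtain ⟨n, hn⟩ := hpow' c (a + b) hc
    rw [h, Ideal.top_pow, top_le_iff] at hn
    exact htop hn
  obtain ⟨v, x, hx, hxa, hxmin⟩ := exists_generators_of_quotient (hne a ha)
  obtain ⟨w, y, hy, hyb, hymin⟩ := exists_generators_of_quotient (hne b hb)
  have hvw : v = w := by
    apply le_antisymm
    · obtain ⟨n, hn⟩ := hpow' b a hb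
      obtain ⟨t, ht⟩ := exists_pow_succ_le_sup_pow hyb
        (Ideal.span_le.2 (Set.range_subset_iff.2 hy)) n
      exact hxmin w y t hy (ht.trans (sup_le_sup_left hn _))
    · obtain ⟨n, hn⟩ := hpow' a b ha
      obtain ⟨t, ht⟩ := exists_pow_succ_le_sup_pow hxa
        (Ideal.span_le.2 (Set.range_subset_iff.2 hx)) n
      exact hymin v x t hx (ht.trans (sup_le_sup_left hn _))
  subst hvw
  obtain ⟨z, hz, hza, hzb⟩ := exists_common_generators x y hx hy hxa hyb
  refine locRedNum_quotient_le htop z hz ((pow_succ_le_sup_mul hza hzb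
    (Ideal.span_le.2 (Set.range_subset_iff.2 hz))).trans (sup_le_sup_left (hfil a b) _)) ?_
  intro w u s hu hs
  exact hxmin w u s hu (hs.trans (sup_le_sup_left (hanti (Nat.le_add_right a b)) _))
end

section
/- Let (R, m) be a local ring with infinite residue field and let {I_n} be a filtration of ideals of R with dim R/I_n = dim R/I_1 for all n ≥ 1. Then r(R/I_n) ≤ (r(R/I_1)+1)·n − 1 for all n ≥ 1. -/
open CMReg IsLocalRing

namespace CMReg

variable {A : Type} [CommRing A]

lemma IsReduction.pow_succ_redIdx {M q : Ideal A} (h : IsReduction M q) :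
    M ^ (redIdx M q + 1) = q * M ^ redIdx M q :=
  Nat.sInf_mem (s := {s : ℕ | M ^ (s + 1) = q * M ^ s}) h.2

lemma IsReduction.map {B : Type} [CommRing B] (f : A →+* B) {M q : Ideal A}
    (h : IsReduction M q) : IsReduction (M.map f) (q.map f) := by
  obtain ⟨hle, s, hs⟩ := h
  refine ⟨Ideal.map_mono hle, s, ?_⟩
  rw [← Ideal.map_pow, hs, Ideal.map_mul, Ideal.map_pow]

lemma locRedNum_eq_zero_of_subsingleton [Subsingleton A] (M : Ideal A) : locRedNum M = 0 := by
  refine Nat.sInf_eq_zero.mpr (Or.inl ⟨M, ⟨⟨le_rfl, 0, Subsingleton.elim _ _⟩,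
    fun _ _ _ => Subsingleton.elim _ _⟩, ?_⟩)
  exact Nat.sInf_eq_zero.mpr (Or.inl (Subsingleton.elim _ _))

/-- By Nakayama's lemma, the relation `M ^ (s + 1) = K * M ^ s` only depends on `K` modulo
`M ^ 2`. -/
lemma pow_succ_eq_mul_of_le_sup_sq [IsNoetherianRing A] {M K L : Ideal A}
    (hM : M ≤ Ideal.jacobson ⊥) (hLM : L ≤ M) (hKL : K ≤ L ⊔ M ^ 2) {s : ℕ}
    (hs : M ^ (s + 1) = K * M ^ s) : M ^ (s + 1) = L * M ^ s := by
  apply le_antisymm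
  · refine Submodule.le_of_le_smul_of_le_jacobson_bot (IsNoetherian.noetherian _) hM ?_
    calc M ^ (s + 1) = K * M ^ s := hs
      _ ≤ (L ⊔ M ^ 2) * M ^ s := Ideal.mul_mono_left hKL
      _ = L * M ^ s ⊔ M • M ^ (s + 1) := by
        rw [Ideal.sup_mul, smul_eq_mul, ← pow_succ', ← pow_add, Nat.add_comm 2 s]
  · rw [pow_succ']
    exact Ideal.mul_mono_left hLM

section Local

open IsLocalRing

variable [IsLocalRing A]

lemma isArtinianRing_quotient_maximalIdeal_pow [IsNoetherianRing A] (j : ℕ) :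
    IsArtinianRing (A ⧸ maximalIdeal A ^ j) := by
  rcases subsingleton_or_nontrivial (A ⧸ maximalIdeal A ^ j) with h | h
  · infer_instance
  · have : IsLocalRing (A ⧸ maximalIdeal A ^ j) :=
      IsLocalRing.of_surjective' (Ideal.Quotient.mk _) Ideal.Quotient.mk_surjective
    rw [isArtinianRing_iff_isNilpotent_maximalIdeal]
    refine ⟨j, ?_⟩
    rw [← map_maximalIdeal_of_surjective (Ideal.Quotient.mk _) Ideal.Quotient.mk_surjective,
      ← Ideal.map_pow, Ideal.map_quotient_self, Ideal.zero_eq_bot]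

lemma exists_minimal_of_maximalIdeal_pow_le [IsNoetherianRing A] (j : ℕ) {S : Set (Ideal A)}
    (hne : S.Nonempty) (hS : ∀ L ∈ S, maximalIdeal A ^ j ≤ L) :
    ∃ L ∈ S, ∀ L' ∈ S, L' ≤ L → L' = L := by
  have := isArtinianRing_quotient_maximalIdeal_pow (A := A) j
  obtain ⟨_, ⟨L, hL, rfl⟩, hmin⟩ := WellFounded.has_min
    (wellFounded_lt (α := Ideal (A ⧸ maximalIdeal A ^ j)))
    (Ideal.map (Ideal.Quotient.mk _) '' S) (hne.image _)
  have hcomap : ∀ K ∈ S, ((K.map (Ideal.Quotient.mk (maximalIdeal A ^ j))).comap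
      (Ideal.Quotient.mk _)) = K := fun K hK => by
    rw [Ideal.comap_map_of_surjective' _ Ideal.Quotient.mk_surjective, Ideal.mk_ker,
      sup_eq_left.mpr (hS K hK)]
  refine ⟨L, hL, fun L' hL' hle => ?_⟩
  rw [← hcomap L hL, ← hcomap L' hL',
    eq_of_le_of_not_lt (Ideal.map_mono hle) (hmin _ ⟨L', hL', rfl⟩)]

/-- Every reduction of the maximal ideal of a Noetherian local ring contains a minimal one. -/
lemma IsReduction.exists_isMinReduction_le [IsNoetherianRing A] {q : Ideal A}
    (hq : IsReduction (maximalIdeal A) q) :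
    ∃ q' ≤ q, IsMinReduction (maximalIdeal A) q' := by
  set M := maximalIdeal A
  obtain ⟨_, ⟨K, ⟨hKq, hK⟩, rfl⟩, hKmin⟩ := exists_minimal_of_maximalIdeal_pow_le (A := A) 2
    (S := (fun K => K ⊔ M ^ 2) '' {K | K ≤ q ∧ IsReduction M K}) ⟨_, q, ⟨le_rfl, hq⟩, rfl⟩
    (by rintro _ ⟨K, -, rfl⟩; exact le_sup_right)
  obtain ⟨hKM, s, hs⟩ := hK
  have hpow : ∀ L ≤ K, IsReduction M L → M ^ (s + 1) ≤ L := fun L hLK hL => by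
    have hsup := hKmin _ ⟨L, ⟨hLK.trans hKq, hL⟩, rfl⟩ (sup_le_sup_right hLK _)
    rw [pow_succ_eq_mul_of_le_sup_sq (maximalIdeal_le_jacobson _) hL.1
      (le_sup_left.trans hsup.ge) hs]
    exact Ideal.mul_le_left (I := L)
  obtain ⟨L, ⟨hLK, hL⟩, hLmin⟩ := exists_minimal_of_maximalIdeal_pow_le (A := A) (s + 1)
    (S := {L | L ≤ K ∧ IsReduction M L}) ⟨K, le_rfl, hKM, s, hs⟩ (fun L h => hpow L h.1 h.2)
  exact ⟨L, hLK.trans hKq, hL, fun L' hle hL' => hLmin L' ⟨hle.trans hLK, hL'⟩ hle⟩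

lemma exists_isMinReduction_redIdx_eq_locRedNum [IsNoetherianRing A] :
    ∃ q : Ideal A, IsMinReduction (maximalIdeal A) q ∧
      redIdx (maximalIdeal A) q = locRedNum (maximalIdeal A) := by
  have hself : IsReduction (maximalIdeal A) (maximalIdeal A) := ⟨le_rfl, 0, by simp⟩
  obtain ⟨q, -, hq⟩ := hself.exists_isMinReduction_le
  exact Nat.sInf_mem (s := {s : ℕ | ∃ q : Ideal A, IsMinReduction (maximalIdeal A) q ∧
    redIdx (maximalIdeal A) q = s}) ⟨_, q, hq, rfl⟩

end Local

lemma pow_mul_le_mul_pow_sup {M Q J : Ideal A} {r : ℕ} (hJ : J ≤ M ^ (r + 1))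
    (h : M ^ (r + 1) ≤ Q * M ^ r ⊔ J) (n : ℕ) :
    M ^ ((r + 1) * n + r + 1) ≤ Q * M ^ ((r + 1) * n + r) ⊔ J ^ (n + 1) := by
  induction n with
  | zero => simpa using h
  | succ n ih =>
    have hJn : J ^ (n + 1) ≤ M ^ ((r + 1) * (n + 1)) := by
      rw [pow_mul]
      exact Ideal.pow_right_mono hJ (n + 1)
    calc M ^ ((r + 1) * (n + 1) + r + 1)
        = M ^ ((r + 1) * n + r + 1) * M ^ (r + 1) := by rw [← pow_add]; ring_nf
      _ ≤ (Q * M ^ ((r + 1) * n + r) ⊔ J ^ (n + 1)) * M ^ (r + 1) := Ideal.mul_mono_left ih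
      _ = Q * M ^ ((r + 1) * n + r) * M ^ (r + 1) ⊔ J ^ (n + 1) * M ^ (r + 1) :=
        Ideal.sup_mul _ _ _
      _ ≤ Q * M ^ ((r + 1) * (n + 1) + r) ⊔ J ^ (n + 1 + 1) := by
        refine sup_le ?_ ?_
        · rw [mul_assoc, ← pow_add]
          refine le_trans (le_of_eq ?_) le_sup_left
          ring_nf
        · calc J ^ (n + 1) * M ^ (r + 1) ≤ J ^ (n + 1) * (Q * M ^ r ⊔ J) :=
                Ideal.mul_mono_right h
            _ = Q * (J ^ (n + 1) * M ^ r) ⊔ J ^ (n + 1 + 1) := by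
              rw [Ideal.mul_sup, ← pow_succ, mul_left_comm]
            _ ≤ Q * M ^ ((r + 1) * (n + 1) + r) ⊔ J ^ (n + 1 + 1) := by
              refine sup_le_sup_right (Ideal.mul_mono_right ?_) _
              exact (Ideal.mul_mono_left hJn).trans (pow_add _ _ _).ge

lemma pow_eq_mul_pow_of_ker_pow_eq_bot {B : Type} [CommRing B] {f : A →+* B}
    (hf : Function.Surjective f) {n : ℕ} (hker : RingHom.ker f ^ (n + 1) = ⊥) {M Q : Ideal A}
    (hQM : Q ≤ M) {r : ℕ} (h : M.map f ^ (r + 1) = Q.map f * M.map f ^ r) :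
    M ^ ((r + 1) * n + r + 1) = Q * M ^ ((r + 1) * n + r) := by
  have hQr : Q * M ^ r ≤ M ^ (r + 1) := by
    rw [pow_succ']
    exact Ideal.mul_mono_left hQM
  have hle : M ^ (r + 1) ≤ Q * M ^ r ⊔ RingHom.ker f := by
    rw [← Ideal.comap_map_of_surjective' f hf, Ideal.map_mul, Ideal.map_pow, ← h, ← Ideal.map_pow]
    exact Ideal.le_comap_map
  have hle' : M ^ (r + 1) ≤ Q * M ^ r ⊔ RingHom.ker f ⊓ M ^ (r + 1) := by
    rw [← sup_inf_assoc_of_le _ hQr]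
    exact le_inf hle le_rfl
  have hbot : (RingHom.ker f ⊓ M ^ (r + 1)) ^ (n + 1) = ⊥ :=
    le_bot_iff.mp ((Ideal.pow_right_mono inf_le_left _).trans hker.le)
  apply le_antisymm
  · simpa [hbot] using pow_mul_le_mul_pow_sup inf_le_right hle' n
  · rw [pow_succ']
    exact Ideal.mul_mono_left hQM

open IsLocalRing in
/-- Reduction numbers along a surjection of local rings with nilpotent kernel. -/
lemma locRedNum_le_of_ker_pow_eq_bot [IsLocalRing A] [IsNoetherianRing A] {B : Type}
    [CommRing B] [IsLocalRing B] [IsNoetherianRing B] {f : A →+* B}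
    (hf : Function.Surjective f) {n : ℕ} (hker : RingHom.ker f ^ (n + 1) = ⊥) :
    locRedNum (maximalIdeal A) ≤
      (locRedNum (maximalIdeal B) + 1) * n + locRedNum (maximalIdeal B) := by
  obtain ⟨q, hq, hr⟩ := exists_isMinReduction_redIdx_eq_locRedNum (A := B)
  have hqr := hq.1.pow_succ_redIdx
  rw [hr] at hqr
  set r := locRedNum (maximalIdeal B)
  have hM : (maximalIdeal A).map f = maximalIdeal B := map_maximalIdeal_of_surjective f hf
  have hlift : ∀ Q ≤ maximalIdeal A, Q.map f = q →
      maximalIdeal A ^ ((r + 1) * n + r + 1) = Q * maximalIdeal A ^ ((r + 1) * n + r) :=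
    fun Q hQ hQq => pow_eq_mul_pow_of_ker_pow_eq_bot hf hker hQ (by rw [hM, hQq, hqr])
  have hqM : q.comap f ≤ maximalIdeal A := by
    have : IsLocalHom f := hf.isLocalHom
    rw [← maximalIdeal_comap f]
    exact Ideal.comap_mono hq.1.1
  have hmap : (q.comap f).map f = q := Ideal.map_comap_of_surjective f hf q
  obtain ⟨Q, hQle, hQ⟩ := IsReduction.exists_isMinReduction_le ⟨hqM, _, hlift _ hqM hmap⟩
  have hQq : Q.map f = q := hq.2 _ ((Ideal.map_mono hQle).trans hmap.le) (hM ▸ hQ.1.map f)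
  calc locRedNum (maximalIdeal A) ≤ redIdx (maximalIdeal A) Q := Nat.sInf_le ⟨Q, hQ, rfl⟩
    _ ≤ (r + 1) * n + r := Nat.sInf_le (hlift Q hQ.1.1 hQq)

end CMReg

/-- Let `(R, m)` be a (Noetherian) local ring with infinite residue
field and let `{Iₙ}` be a filtration of ideals of `R` with `dim R/Iₙ = dim R/I₁` for
all `n ≥ 1`.  Then `r(R/Iₙ) ≤ (r(R/I₁) + 1)·n − 1` for all `n ≥ 1`. -/
theorem statement_4 {R : Type} [CommRing R] [IsLocalRing R] [IsNoetherianRing R]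
    [Infinite (ResidueField R)] (I : ℕ → Ideal R)
    (hI0 : I 0 = ⊤) (hdec : ∀ n, I (n + 1) ≤ I n)
    (hfil : ∀ a b, I a * I b ≤ I (a + b))
    (hdim : ∀ n ≥ 1, ringKrullDim (R ⧸ I n) = ringKrullDim (R ⧸ I 1)) :
    ∀ n : ℕ, 1 ≤ n →
      (locRedNum ((maximalIdeal R).map (Ideal.Quotient.mk (I n))) : ℤ)
        ≤ ((locRedNum ((maximalIdeal R).map (Ideal.Quotient.mk (I 1))) : ℤ) + 1) * n - 1 := by
  have hanti : Antitone I := antitone_nat_of_succ_le hdec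
  have hpow : ∀ n, I 1 ^ n ≤ I n := by
    intro n
    induction n with
    | zero => simp [hI0]
    | succ n ih =>
      rw [pow_succ]
      exact (Ideal.mul_mono_left ih).trans (hfil n 1)
  intro n hn
  obtain ⟨n, rfl⟩ := Nat.exists_eq_add_of_le' hn
  by_cases h1 : I 1 = ⊤
  · have : Subsingleton (R ⧸ I (n + 1)) := Ideal.Quotient.subsingleton_iff.mpr
      (top_le_iff.mp (by simpa only [h1, Ideal.top_pow] using hpow (n + 1)))
    rw [locRedNum_eq_zero_of_subsingleton]
    push_cast
    nlinarith [Nat.cast_nonneg (α := ℤ) n,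
      Nat.cast_nonneg (α := ℤ) (locRedNum ((maximalIdeal R).map (Ideal.Quotient.mk (I 1))))]
  · have hle : I (n + 1) ≤ I 1 := hanti hn
    have hlocal : ∀ J ≤ I 1, IsLocalRing (R ⧸ J) := fun J hJ => by
      have := Ideal.Quotient.nontrivial_iff.mpr (ne_top_of_le_ne_top h1 hJ)
      exact .of_surjective' (Ideal.Quotient.mk J) Ideal.Quotient.mk_surjective
    have := hlocal _ hle
    have := hlocal _ le_rfl
    rw [map_maximalIdeal_of_surjective _ Ideal.Quotient.mk_surjective,
      map_maximalIdeal_of_surjective _ Ideal.Quotient.mk_surjective]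
    have hker : RingHom.ker (Ideal.Quotient.factor hle) ^ (n + 1) = ⊥ := by
      rw [Ideal.Quotient.factor_ker, ← Ideal.map_pow, Ideal.map_eq_bot_iff_le_ker, Ideal.mk_ker]
      exact hpow (n + 1)
    have hmain := locRedNum_le_of_ker_pow_eq_bot (Ideal.Quotient.factor_surjective hle) hker
    zify at hmain
    push_cast
    linarith
end
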